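/- Let a = a(ε) ≥ 0 be bounded as ε → 0 with a₀ := lim_{ε→0} a(ε) existing, let v_{ε,a} be a global minimizer of E, and let r₀ > ρ. Then lim_{ε→0} v_{ε,a}((r₀ + tε)e^{iθ})/ε = −(a₀/μ_rad(r₀)) f(r₀ e^{iθ}), uniformly as t remains in a bounded set and θ ranges over ℝ. -/

import Mathlib

open MeasureTheory Filter Real Set
open scoped Topology ENNReal

noncomputable section

/-- We identify the plane with the Euclidean space `ℝ²`. -/
abbrev E2 : Type := EuclideanSpace ℝ (Fin 2)

/-- The standard basis vectors of `ℝ²`. -/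
def e2basis (i : Fin 2) : E2 := EuclideanSpace.single i 1

/-- Rotation of a vector by `π/2` (multiplication by `i` in complex notation). -/
def perp (e : E2) : E2 := EuclideanSpace.single 0 (-(e 1)) + EuclideanSpace.single 1 (e 0)

/-- The unit vector `e^{iθ}`. -/
def uvec (θ : ℝ) : E2 := EuclideanSpace.single 0 (Real.cos θ) + EuclideanSpace.single 1 (Real.sin θ)

/-- The Laplacian of a map `u : ℝ² → ℝ²`. -/
def lap (u : E2 → E2) (x : E2) : E2 :=
  ∑ i : Fin 2, fderiv ℝ (fun y => fderiv ℝ u y (e2basis i)) x (e2basis i)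

/-- `|∇u|²`, the squared Hilbert-Schmidt norm of the full gradient of `u : ℝ² → ℝ²`. -/
def gradSq (u : E2 → E2) (x : E2) : ℝ := ∑ i : Fin 2, ‖fderiv ℝ u x (e2basis i)‖ ^ 2

/-- `∑_j ∇u_j · ∇ψ_j`, the Hilbert-Schmidt inner product of the gradients. -/
def gradInner (u ψ : E2 → E2) (x : E2) : ℝ :=
  ∑ i : Fin 2, (inner ℝ (fderiv ℝ u x (e2basis i)) (fderiv ℝ ψ x (e2basis i)) : ℝ)

/-- Membership in `H¹(ℝ²,ℝ²)`: `u ∈ L²` together with its gradient. -/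
def MemH1 (u : E2 → E2) : Prop :=
  Differentiable ℝ u ∧ MemLp u 2 (volume : Measure E2) ∧
    MemLp (fun x => fderiv ℝ u x) 2 (volume : Measure E2)

/-- The Ginzburg–Landau energy
`E(u) = ∫ (1/2)|∇u|² − (1/(2ε²))μ|u|² + (1/(4ε²))|u|⁴ − (a/ε) f·u`. -/
def energy (ε a : ℝ) (μ : E2 → ℝ) (f : E2 → E2) (u : E2 → E2) : ℝ :=
  ∫ x : E2, ((1/2) * gradSq u x - (1/(2*ε^2)) * μ x * ‖u x‖^2
    + (1/(4*ε^2)) * ‖u x‖^4 - (a/ε) * (inner ℝ (f x) (u x) : ℝ))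

/-- `v` is a global minimizer of `E` over `H¹(ℝ²,ℝ²)`. -/
def IsMinimizer (ε a : ℝ) (μ : E2 → ℝ) (f : E2 → E2) (v : E2 → E2) : Prop :=
  MemH1 v ∧ ∀ u : E2 → E2, MemH1 u → energy ε a μ f v ≤ energy ε a μ f u

/-- `u` is a smooth classical solution of the Euler–Lagrange equation
`ε²Δu + μu − |u|²u + εa f = 0` on `ℝ²`. -/
def IsSolution (ε a : ℝ) (μ : E2 → ℝ) (f : E2 → E2) (u : E2 → E2) : Prop :=
  ContDiff ℝ (⊤ : ℕ∞) u ∧ ∀ x : E2, ε^2 • lap u x + μ x • u x - ‖u x‖^2 • u x + (ε*a) • f x = 0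

/-- Hypotheses on the radial coefficient `μ`. -/
structure MuHyp (μ : E2 → ℝ) (μrad : ℝ → ℝ) (ρ : ℝ) : Prop where
  smooth : ContDiff ℝ (⊤ : ℕ∞) μ
  smooth_rad : ContDiff ℝ (⊤ : ℕ∞) μrad
  even_rad : ∀ r : ℝ, μrad (-r) = μrad r
  radial : ∀ x : E2, μ x = μrad ‖x‖
  bdd : ∃ C : ℝ, ∀ x : E2, |μ x| ≤ C
  deriv_neg : ∀ r : ℝ, 0 < r → deriv μrad r < 0
  rho_pos : 0 < ρ
  rho_root : μrad ρ = 0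
  rho_unique : ∀ r : ℝ, 0 < r → μrad r = 0 → r = ρ

/-- Hypotheses on the radial vector field `f`. -/
structure FHyp (f : E2 → E2) (frad : ℝ → ℝ) : Prop where
  smooth : ContDiff ℝ (⊤ : ℕ∞) f
  smooth_rad : ContDiff ℝ (⊤ : ℕ∞) frad
  odd_rad : ∀ r : ℝ, frad (-r) = -frad r
  radial : ∀ x : E2, x ≠ 0 → f x = (frad ‖x‖ / ‖x‖) • x
  integrable : Integrable f (volume : Measure E2)
  bdd : ∃ C : ℝ, ∀ x : E2, ‖f x‖ ≤ C
  pos_rad : ∀ r : ℝ, 0 < r → 0 < frad r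

/-- Convergence in `C²_loc(ℝ²,ℝ²)` of a sequence of maps. -/
def TendstoC2LocSeq (F : ℕ → E2 → E2) (g : E2 → E2) : Prop :=
  TendstoLocallyUniformly F g atTop ∧
  TendstoLocallyUniformly (fun n x => fderiv ℝ (F n) x) (fun x => fderiv ℝ g x) atTop ∧
  TendstoLocallyUniformly (fun n x => fderiv ℝ (fderiv ℝ (F n)) x)
    (fun x => fderiv ℝ (fderiv ℝ g) x) atTop

/-- `l` is a limit point (as `ε → 0`) of the set of zeros of the family `v ε`. -/
def IsZeroLimitPoint (v : ℝ → E2 → E2) (l : E2) : Prop :=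
  ∃ (εs : ℕ → ℝ) (xs : ℕ → E2), (∀ n, 0 < εs n) ∧ Tendsto εs atTop (𝓝 (0:ℝ)) ∧
    (∀ n, v (εs n) (xs n) = 0) ∧ Tendsto xs atTop (𝓝 l)

lemma memLp_add_smul {F : Type*} [NormedAddCommGroup F] [NormedSpace ℝ F] {p q : E2 → F} (s : ℝ)
    (hp : MemLp p 2 (volume : Measure E2)) (hq : MemLp q 2 (volume : Measure E2)) :
    MemLp (fun x => p x + s • q x) 2 (volume : Measure E2) :=
  hp.add (hq.const_smul s)

lemma memLp_pd {v : E2 → E2} (hv : MemLp (fun x => fderiv ℝ v x) 2 (volume : Measure E2)) (i : Fin 2) :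
    MemLp (fun x => fderiv ℝ v x (e2basis i)) 2 (volume : Measure E2) :=
  (ContinuousLinearMap.apply ℝ E2 (e2basis i)).comp_memLp' hv

lemma integrable_inner_of_memLp {f g : E2 → E2} (hf : MemLp f 2 (volume : Measure E2))
    (hg : MemLp g 2 (volume : Measure E2)) : Integrable (fun x => (inner ℝ (f x) (g x) : ℝ)) := by
  have h1 := hf.integrable_norm_pow (by norm_num)
  have h2 := hg.integrable_norm_pow (by norm_num)
  refine (h1.add h2).mono' (hf.1.inner hg.1) (Eventually.of_forall fun x => ?_)
  have := norm_inner_le_norm (𝕜 := ℝ) (f x) (g x)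
  simp only [Pi.add_apply]
  norm_num
  norm_num at this
  nlinarith [sq_nonneg (‖f x‖ - ‖g x‖), sq_nonneg (‖f x‖ + ‖g x‖)]

lemma integrable_normsq_of_memLp {f : E2 → E2} (hf : MemLp f 2 (volume : Measure E2)) :
    Integrable (fun x => ‖f x‖ ^ 2) := by
  simpa using hf.integrable_norm_pow (by norm_num)

lemma poly_first_zero {J1 J2 J3 J4 : ℝ}
    (h : ∀ s : ℝ, 0 ≤ s * J1 + s ^ 2 * J2 + s ^ 3 * J3 + s ^ 4 * J4) : J1 = 0 := by
  set P : ℝ → ℝ := fun s => s * J1 + s ^ 2 * J2 + s ^ 3 * J3 + s ^ 4 * J4 with hP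
  have hmin : IsLocalMin P 0 := by
    refine Eventually.of_forall fun s => ?_
    simpa [hP] using h s
  have hd : HasDerivAt P J1 0 := by
    have h1 : HasDerivAt (fun s : ℝ => s * J1) (1 * J1) 0 := (hasDerivAt_id 0).mul_const J1
    have h2 := ((hasDerivAt_pow 2 (0:ℝ)).mul_const J2)
    have h3 := ((hasDerivAt_pow 3 (0:ℝ)).mul_const J3)
    have h4 := ((hasDerivAt_pow 4 (0:ℝ)).mul_const J4)
    have := ((h1.add h2).add h3).add h4
    exact this.congr_deriv (by norm_num)
  exact hmin.hasDerivAt_eq_zero hd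

/-- energy density -/
def edens (ε a : ℝ) (μ : E2 → ℝ) (f : E2 → E2) (u : E2 → E2) (x : E2) : ℝ :=
  ((1/2) * gradSq u x - (1/(2*ε^2)) * μ x * ‖u x‖^2
    + (1/(4*ε^2)) * ‖u x‖^4 - (a/ε) * (inner ℝ (f x) (u x) : ℝ))

lemma weak_EL {ε a : ℝ} {μ : E2 → ℝ} {f v ψ : E2 → E2} (hμ : Continuous μ)
    (hf : Continuous f) (hmin : IsMinimizer ε a μ f v)
    (hEdens : Integrable (edens ε a μ f v))
    (hψ : Differentiable ℝ ψ) (hψc : HasCompactSupport ψ)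
    (hψ2 : MemLp (fun x => fderiv ℝ ψ x) 2 (volume : Measure E2)) :
    ∫ x, (gradInner v ψ x - (1/ε^2) * μ x * (inner ℝ (v x) (ψ x) : ℝ)
      + (1/ε^2) * ‖v x‖^2 * (inner ℝ (v x) (ψ x) : ℝ) - (a/ε) * (inner ℝ (f x) (ψ x) : ℝ)) = 0 := by
  obtain ⟨⟨hvd, hv2, hdv2⟩, hm⟩ := hmin
  have hvc := hvd.continuous
  have hψcont := hψ.continuous
  -- integrability
  have hz : ∀ g : E2 → ℝ, Continuous g → (∀ x, ψ x = 0 → g x = 0) → Integrable g := by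
    intro g hg h0
    apply hg.integrable_of_hasCompactSupport
    exact hψc.mono (fun x hx hx0 => hx (h0 x hx0))
  have hgI : Integrable (gradInner v ψ) := by
    unfold gradInner
    exact integrable_finsetSum _ fun i _ => integrable_inner_of_memLp (memLp_pd hdv2 i) (memLp_pd hψ2 i)
  have hgS : Integrable (gradSq ψ) := by
    unfold gradSq
    exact integrable_finsetSum _ fun i _ => integrable_normsq_of_memLp (memLp_pd hψ2 i)
  set I1 : E2 → ℝ := fun x => (gradInner v ψ x - (1/ε^2) * μ x * (inner ℝ (v x) (ψ x) : ℝ)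
      + (1/ε^2) * ‖v x‖^2 * (inner ℝ (v x) (ψ x) : ℝ) - (a/ε) * (inner ℝ (f x) (ψ x) : ℝ)) with hI1
  set I2 : E2 → ℝ := fun x => (1/2) * gradSq ψ x + (-(1/(2*ε^2)) * μ x * ‖ψ x‖^2
      + (1/(4*ε^2)) * (4 * (inner ℝ (v x) (ψ x) : ℝ)^2 + 2 * ‖v x‖^2 * ‖ψ x‖^2)) with hI2
  set I3 : E2 → ℝ := fun x => (1/ε^2) * (inner ℝ (v x) (ψ x) : ℝ) * ‖ψ x‖^2 with hI3
  set I4 : E2 → ℝ := fun x => (1/(4*ε^2)) * ‖ψ x‖^4 with hI4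
  have i1 : Integrable I1 := by
    refine ((hgI.sub (hz (fun x => (1/ε^2) * μ x * (inner ℝ (v x) (ψ x) : ℝ)) ?_ ?_)).add
      (hz (fun x => (1/ε^2) * ‖v x‖^2 * (inner ℝ (v x) (ψ x) : ℝ)) ?_ ?_)).sub
      (hz (fun x => (a/ε) * (inner ℝ (f x) (ψ x) : ℝ)) ?_ ?_)
    all_goals first | fun_prop | (intro x hx; simp [hx])
  have i2 : Integrable I2 := by
    refine (hgS.const_mul (1/2)).add (hz _ ?_ ?_)
    · fun_prop
    · intro x hx; simp [hx]
  have i3 : Integrable I3 := by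
    refine hz _ ?_ ?_
    · fun_prop
    · intro x hx; simp [hI3, hx]
  have i4 : Integrable I4 := by
    refine hz _ ?_ ?_
    · fun_prop
    · intro x hx; simp [hI4, hx]
  apply poly_first_zero (J2 := ∫ x, I2 x) (J3 := ∫ x, I3 x) (J4 := ∫ x, I4 x)
  intro s
  have hψL : MemLp ψ 2 (volume : Measure E2) := hψcont.memLp_of_hasCompactSupport hψc
  have hfd : ∀ x, fderiv ℝ (fun y => v y + s • ψ y) x = fderiv ℝ v x + s • fderiv ℝ ψ x := by
    intro x
    exact ((hvd x).hasFDerivAt.add ((hψ x).hasFDerivAt.const_smul s)).fderiv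
  have hH1 : MemH1 (fun y => v y + s • ψ y) := by
    refine ⟨by fun_prop, memLp_add_smul s hv2 hψL, ?_⟩
    have : (fun x => fderiv ℝ (fun y => v y + s • ψ y) x) = fun x => fderiv ℝ v x + s • fderiv ℝ ψ x :=
      funext hfd
    rw [this]; exact memLp_add_smul s hdv2 hψ2
  have hle := hm _ hH1
  have hexp : ∀ x, edens ε a μ f (fun y => v y + s • ψ y) x =
      edens ε a μ f v x + (s * I1 x + s^2 * I2 x + s^3 * I3 x + s^4 * I4 x) := by
    intro x
    have n2 : ∀ p q : E2, ‖p + s • q‖^2 = ‖p‖^2 + 2 * s * (inner ℝ p q : ℝ) + s^2 * ‖q‖^2 := by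
      intro p q
      rw [norm_add_sq_real, inner_smul_right, norm_smul, mul_pow]
      simp; ring
    have n4 : ‖v x + s • ψ x‖^4 = (‖v x‖^2 + 2 * s * (inner ℝ (v x) (ψ x) : ℝ) + s^2 * ‖ψ x‖^2)^2 := by
      rw [← n2]; ring
    simp only [edens, hI1, hI2, hI3, hI4, gradSq, gradInner, hfd, Fin.sum_univ_two,
      _root_.add_apply, _root_.smul_apply, n2, n4, inner_add_right,
      inner_smul_right]
    by_cases hε : ε = 0
    · subst hε; simp; ring
    · field_simp; ring
  have e1 : energy ε a μ f (fun y => v y + s • ψ y) = ∫ x, edens ε a μ f (fun y => v y + s • ψ y) x := rfl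
  have e0 : energy ε a μ f v = ∫ x, edens ε a μ f v x := rfl
  rw [e1, e0] at hle
  simp_rw [hexp] at hle
  have j1 := i1.const_mul s
  have j2 := i2.const_mul (s^2)
  have j3 := i3.const_mul (s^3)
  have j4 := i4.const_mul (s^4)
  have j5 : Integrable (fun x => s * I1 x + s^2 * I2 x + s^3 * I3 x + s^4 * I4 x) :=
    ((j1.add j2).add j3).add j4
  rw [integral_add hEdens j5] at hle
  have : ∫ x, (s * I1 x + s^2 * I2 x + s^3 * I3 x + s^4 * I4 x) =
      s * (∫ x, I1 x) + s^2 * (∫ x, I2 x) + s^3 * (∫ x, I3 x) + s^4 * (∫ x, I4 x) := by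
    have k1 : ∫ x, (s * I1 x + s^2 * I2 x + s^3 * I3 x + s^4 * I4 x) =
      (∫ x, (s * I1 x + s^2 * I2 x + s^3 * I3 x)) + ∫ x, s^4 * I4 x := integral_add ((j1.add j2).add j3) j4
    have k2 : ∫ x, (s * I1 x + s^2 * I2 x + s^3 * I3 x) =
      (∫ x, (s * I1 x + s^2 * I2 x)) + ∫ x, s^3 * I3 x := integral_add (j1.add j2) j3
    have k3 : ∫ x, (s * I1 x + s^2 * I2 x) =
      (∫ x, (s * I1 x)) + ∫ x, s^2 * I2 x := integral_add j1 j2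
    rw [k1, k2, k3]
    simp only [integral_const_mul]
  linarith

/-- scalar Laplacian -/
def lapS (u : E2 → ℝ) (x : E2) : ℝ :=
  ∑ i : Fin 2, fderiv ℝ (fun y => fderiv ℝ u y (e2basis i)) x (e2basis i)

lemma contDiff_pd {F : Type*} [NormedAddCommGroup F] [NormedSpace ℝ F] {g : E2 → F}
    (hg : ContDiff ℝ (⊤ : ℕ∞) g) (e : E2) : ContDiff ℝ (⊤ : ℕ∞) (fun y => fderiv ℝ g y e) :=
  (hg.fderiv_right (m := (⊤ : ℕ∞)) (by simp)).clm_apply contDiff_const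

lemma hcs_pd {F : Type*} [NormedAddCommGroup F] [NormedSpace ℝ F] {g : E2 → F}
    (hg : HasCompactSupport g) (e : E2) : HasCompactSupport (fun y => fderiv ℝ g y e) :=
  hg.fderiv_apply ℝ e

lemma continuous_lapS {g : E2 → ℝ} (hg : ContDiff ℝ (⊤ : ℕ∞) g) : Continuous (lapS g) := by
  unfold lapS
  exact continuous_finsetSum _ fun i _ => (contDiff_pd (contDiff_pd hg _) _).continuous

lemma continuous_lap {g : E2 → E2} (hg : ContDiff ℝ (⊤ : ℕ∞) g) : Continuous (lap g) := by
  unfold lap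
  exact continuous_finsetSum _ fun i _ => (contDiff_pd (contDiff_pd hg _) _).continuous

lemma hcs_lapS {g : E2 → ℝ} (hg : HasCompactSupport g) : HasCompactSupport (lapS g) := by
  unfold lapS
  simp only [Fin.sum_univ_two]
  exact (hcs_pd (hcs_pd hg _) _).add (hcs_pd (hcs_pd hg _) _)

lemma memH1_smooth {H : E2 → E2} (hH : ContDiff ℝ (⊤ : ℕ∞) H) (hHc : HasCompactSupport H) : MemH1 H := by
  refine ⟨hH.differentiable (by simp), hH.continuous.memLp_of_hasCompactSupport hHc, ?_⟩
  exact (hH.continuous_fderiv (by simp)).memLp_of_hasCompactSupport (hHc.fderiv (𝕜 := ℝ))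

lemma ibp_A {H ψ : E2 → E2} (hH : ContDiff ℝ (⊤ : ℕ∞) H) (hHc : HasCompactSupport H)
    (hψ : MemH1 ψ) : ∫ x, gradInner H ψ x = - ∫ x, (inner ℝ (lap H x) (ψ x) : ℝ) := by
  have hHi := memH1_smooth hH hHc
  have hi2 : ∀ i, MemLp (fun x => fderiv ℝ (fun y => fderiv ℝ H y (e2basis i)) x (e2basis i)) 2
      (volume : Measure E2) := fun i =>
    (contDiff_pd (contDiff_pd hH _) _).continuous.memLp_of_hasCompactSupport (hcs_pd (hcs_pd hHc _) _)
  have key : ∀ i : Fin 2, ∫ x, (inner ℝ (fderiv ℝ H x (e2basis i)) (fderiv ℝ ψ x (e2basis i)) : ℝ)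
      = - ∫ x, (inner ℝ (fderiv ℝ (fun y => fderiv ℝ H y (e2basis i)) x (e2basis i)) (ψ x) : ℝ) := by
    intro i
    have := integral_bilinear_fderiv_right_eq_neg_left_of_integrable (μ := (volume : Measure E2))
      (f := fun y => fderiv ℝ H y (e2basis i)) (g := ψ) (v := e2basis i) (B := innerSL ℝ)
      (integrable_inner_of_memLp (hi2 i) hψ.2.1)
      (integrable_inner_of_memLp (memLp_pd hHi.2.2 i) (memLp_pd hψ.2.2 i))
      (integrable_inner_of_memLp (memLp_pd hHi.2.2 i) hψ.2.1)
      (fun x _ => (contDiff_pd hH _).differentiable (by simp) x)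
      (fun x _ => hψ.1 x)
    exact this
  simp only [gradInner, lap, sum_inner]
  rw [integral_finsetSum, integral_finsetSum, ← Finset.sum_neg_distrib]
  · exact Finset.sum_congr rfl fun i _ => key i
  · exact fun i _ => integrable_inner_of_memLp (hi2 i) hψ.2.1
  · exact fun i _ => integrable_inner_of_memLp (memLp_pd hHi.2.2 i) (memLp_pd hψ.2.2 i)

lemma ibp_gen {p g : E2 → ℝ} (hp : Differentiable ℝ p) {e : E2}
    (hpi : LocallyIntegrable (fun x => fderiv ℝ p x e))
    (hg : ContDiff ℝ (⊤ : ℕ∞) g) (hgc : HasCompactSupport g) :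
    ∫ x, g x * fderiv ℝ p x e = - ∫ x, fderiv ℝ g x e * p x := by
  apply integral_mul_fderiv_eq_neg_fderiv_mul_of_integrable
  · exact ((contDiff_pd hg e).continuous.mul hp.continuous).integrable_of_hasCompactSupport
      (HasCompactSupport.mul_right (hcs_pd hgc e))
  · exact hpi.integrable_smul_left_of_hasCompactSupport hg.continuous hgc
  · exact (hg.continuous.mul hp.continuous).integrable_of_hasCompactSupport hgc.mul_right
  · exact fun x _ => hg.differentiable (by simp) x
  · exact fun x _ => hp x

lemma ibp_lapS {p χ : E2 → ℝ} (hp : Differentiable ℝ p)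
    (hpi : ∀ i, LocallyIntegrable (fun x => fderiv ℝ p x (e2basis i)))
    (hg : ContDiff ℝ (⊤ : ℕ∞) χ) (hgc : HasCompactSupport χ) :
    ∫ x, ∑ i : Fin 2, fderiv ℝ χ x (e2basis i) * fderiv ℝ p x (e2basis i)
      = - ∫ x, lapS χ x * p x := by
  simp only [lapS, Finset.sum_mul]
  rw [integral_finsetSum, integral_finsetSum, ← Finset.sum_neg_distrib]
  · exact Finset.sum_congr rfl fun i _ =>
      ibp_gen hp (hpi i) (contDiff_pd hg _) (hcs_pd hgc _)
  · exact fun i _ => ((contDiff_pd (contDiff_pd hg _) _).continuous.mul hp.continuous).integrable_of_hasCompactSupport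
      (HasCompactSupport.mul_right (hcs_pd (hcs_pd hgc _) _))
  · exact fun i _ => (hpi i).integrable_smul_left_of_hasCompactSupport (contDiff_pd hg _).continuous (hcs_pd hgc _)

lemma fderiv_normsq {u : E2 → E2} (hu : Differentiable ℝ u) (x e : E2) :
    fderiv ℝ (fun y => ‖u y‖^2) x e = 2 * (inner ℝ (fderiv ℝ u x e) (u x) : ℝ) := by
  have := ((hu x).hasFDerivAt.norm_sq).fderiv
  rw [this]
  simp [real_inner_comm]

lemma memH1_smul {u : E2 → E2} {χ : E2 → ℝ} (hu : MemH1 u) (hg : ContDiff ℝ (⊤ : ℕ∞) χ)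
    (hgc : HasCompactSupport χ) : MemH1 (fun x => χ x • u x) := by
  have hχd : Differentiable ℝ χ := hg.differentiable (by simp)
  have hcont := hu.1.continuous
  refine ⟨hχd.smul hu.1, ?_, ?_⟩
  · exact (hg.continuous.smul hcont).memLp_of_hasCompactSupport hgc.smul_right
  · have hfd : (fun x => fderiv ℝ (fun y => χ y • u y) x) = 
        fun x => (fderiv ℝ χ x).smulRight (u x) + (1:ℝ) • (χ x • fderiv ℝ u x) := by
      funext x
      rw [one_smul, add_comm]
      exact ((hχd x).hasFDerivAt.smul (hu.1 x).hasFDerivAt).fderiv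
    rw [hfd]
    apply memLp_add_smul
    · have c1 : Continuous (fun x => (fderiv ℝ χ x).smulRight (u x)) := by
        have := hg.continuous_fderiv (by simp)
        fun_prop
      refine c1.memLp_of_hasCompactSupport ?_
      refine (hgc.fderiv (𝕜 := ℝ)).mono ?_
      intro x hx hx0
      apply hx
      simp only [hx0]
      ext; simp
    · obtain ⟨C, hC⟩ := hg.continuous.bounded_above_of_compact_support hgc
      refine MemLp.of_le_mul (c := C) hu.2.2 (hg.continuous.aestronglyMeasurable.smul hu.2.2.1) ?_
      refine Eventually.of_forall fun x => ?_
      rw [norm_smul]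
      exact mul_le_mul_of_nonneg_right (hC x) (norm_nonneg _)

lemma cubic_mono (v h : E2) :
    (inner ℝ h (v - h) : ℝ) * ‖h‖^2 ≤ ‖v‖^2 * (inner ℝ v (v - h) : ℝ) := by
  have h1 : ‖v - h‖^2 = ‖v‖^2 - 2 * (inner ℝ v h : ℝ) + ‖h‖^2 := norm_sub_sq_real v h
  rw [inner_sub_right, inner_sub_right, real_inner_self_eq_norm_sq, real_inner_self_eq_norm_sq,
    real_inner_comm v h]
  nlinarith [sq_nonneg (‖v‖^2 - ‖h‖^2), sq_nonneg ‖v - h‖, sq_nonneg ‖v‖, sq_nonneg ‖h‖,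
    mul_nonneg (add_nonneg (sq_nonneg ‖v‖) (sq_nonneg ‖h‖)) (sq_nonneg ‖v - h‖)]

lemma pointwise_W {ε a c M m χ : ℝ} (hε : 0 < ε) (hc : 0 < c) (hχ : 0 ≤ χ) (hm : m ≤ -c)
    {v H l f : E2} (heq : m • H + a • f = 0) (hM : ‖l‖ + ‖H‖^3 ≤ M) :
    (c/2) * χ * ‖v - ε • H‖^2 - ε^6 * M^2/(2*c) * χ ≤
      ε^2 * (-ε * (inner ℝ l (χ • (v - ε • H)) : ℝ) +
        (-(1/ε^2) * m * (inner ℝ v (χ • (v - ε • H)) : ℝ)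
          + (1/ε^2) * ‖v‖^2 * (inner ℝ v (χ • (v - ε • H)) : ℝ)
          - (a/ε) * (inner ℝ f (χ • (v - ε • H)) : ℝ))) := by
  set u : E2 := v - ε • H with hu
  have hcub := cubic_mono v (ε • H)
  rw [← hu] at hcub
  have hb1 : |(inner ℝ l u : ℝ)| ≤ ‖l‖ * ‖u‖ := abs_real_inner_le_norm l u
  have hb2 : |(inner ℝ H u : ℝ)| ≤ ‖H‖ * ‖u‖ := abs_real_inner_le_norm H u
  rw [norm_smul, inner_smul_left] at hcub
  simp only [Real.norm_eq_abs, abs_of_pos hε, conj_trivial] at hcub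
  have hlin : m * (inner ℝ v u : ℝ) + ε * a * (inner ℝ f u : ℝ) = m * ‖u‖^2 := by
    have h1 : (inner ℝ (m • H + a • f) u : ℝ) = 0 := by rw [heq]; simp
    rw [inner_add_left, inner_smul_left, inner_smul_left] at h1
    simp only [conj_trivial] at h1
    have h2 : (inner ℝ v u : ℝ) = ‖u‖^2 + ε * (inner ℝ H u : ℝ) := by
      have : v = u + ε • H := by rw [hu]; abel
      conv_lhs => rw [this]
      rw [inner_add_left, inner_smul_left, real_inner_self_eq_norm_sq]
      simp
    rw [h2]; linear_combination ε * h1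
  simp only [inner_smul_right]
  have hR : ε^2 * (-ε * (χ * (inner ℝ l u : ℝ)) +
        (-(1/ε^2) * m * (χ * (inner ℝ v u : ℝ))
          + (1/ε^2) * ‖v‖^2 * (χ * (inner ℝ v u : ℝ))
          - (a/ε) * (χ * (inner ℝ f u : ℝ)))) =
      χ * (-ε^3 * (inner ℝ l u : ℝ) - m * ‖u‖^2 + ‖v‖^2 * (inner ℝ v u : ℝ)) := by
    rw [← hlin]; field_simp; ring
  rw [hR]
  have hu0 := norm_nonneg u
  have hH0 := norm_nonneg H
  have hl0 := norm_nonneg l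
  have hmain : (c/2) * ‖u‖^2 - ε^6 * M^2/(2*c) ≤
      (-ε^3 * (inner ℝ l u : ℝ) - m * ‖u‖^2 + ‖v‖^2 * (inner ℝ v u : ℝ)) := by
    have e3 : 0 < ε^3 := by positivity
    have a1 : -ε^3 * (inner ℝ l u : ℝ) ≥ -(ε^3 * (‖l‖ * ‖u‖)) := by
      have := mul_le_mul_of_nonneg_left ((le_abs_self _).trans hb1) e3.le
      linarith
    have a2 : ‖v‖^2 * (inner ℝ v u : ℝ) ≥ -(ε^3 * (‖H‖^3 * ‖u‖)) := by
      have h3 : -(‖H‖ * ‖u‖) ≤ (inner ℝ H u : ℝ) := by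
        have := neg_abs_le (inner ℝ H u : ℝ); linarith
      have h4 := mul_le_mul_of_nonneg_left h3 (show 0 ≤ ε^3 * ‖H‖^2 by positivity)
      nlinarith
    have a3 : ε^3 * (‖l‖ * ‖u‖) + ε^3 * (‖H‖^3 * ‖u‖) ≤ ε^3 * M * ‖u‖ := by
      have := mul_le_mul_of_nonneg_left (mul_le_mul_of_nonneg_right hM hu0) e3.le
      nlinarith
    have a4 : -m * ‖u‖^2 ≥ c * ‖u‖^2 := by nlinarith [sq_nonneg ‖u‖]
    have a5 : ε^3 * M * ‖u‖ ≤ (c/2) * ‖u‖^2 + ε^6 * M^2/(2*c) := by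
      have : (c/2) * ‖u‖^2 + ε^6 * M^2/(2*c) - ε^3 * M * ‖u‖ = (c * ‖u‖ - ε^3 * M)^2/(2*c) := by
        field_simp; ring
      have h0 : 0 ≤ (c * ‖u‖ - ε^3 * M)^2/(2*c) := by positivity
      linarith
    linarith
  have := mul_le_mul_of_nonneg_left hmain hχ
  linarith

lemma main_ineq {ε a c M : ℝ} (hε : 0 < ε) (hc : 0 < c) {μ : E2 → ℝ} {f v H : E2 → E2} {χ : E2 → ℝ}
    (hμ : Continuous μ) (hf : Continuous f) (hmin : IsMinimizer ε a μ f v)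
    (hEdens : Integrable (edens ε a μ f v)) (S : Set E2) (hS : ∀ x ∈ S, μ x ≤ -c)
    (hH : ContDiff ℝ (⊤ : ℕ∞) H) (hHc : HasCompactSupport H)
    (hHeq : ∀ x ∈ S, μ x • H x + a • f x = 0) (hHM : ∀ x ∈ S, ‖lap H x‖ + ‖H x‖^3 ≤ M)
    (hχ : ContDiff ℝ (⊤ : ℕ∞) χ) (hχc : HasCompactSupport χ) (hχ0 : ∀ x, 0 ≤ χ x)
    (hχS : ∀ x, x ∉ S → χ x = 0) :
    c * (∫ x, χ x * ‖v x - ε • H x‖^2) ≤ ε^2 * (∫ x, lapS χ x * ‖v x - ε • H x‖^2)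
      + (M^2/c) * ε^6 * ∫ x, χ x := by
  have hHi := memH1_smooth hH hHc
  have hvi := hmin.1
  set u : E2 → E2 := fun x => v x - ε • H x with hu
  have hfdu : ∀ x, fderiv ℝ u x = fderiv ℝ v x + (-ε) • fderiv ℝ H x := by
    intro x
    have := ((hvi.1 x).hasFDerivAt.sub ((hHi.1 x).hasFDerivAt.const_smul ε)).fderiv
    have h2 : fderiv ℝ u x = fderiv ℝ v x - ε • fderiv ℝ H x := this
    rw [h2]; ext y i; simp [sub_eq_add_neg]
  have hui : MemH1 u := by
    refine ⟨hvi.1.sub (hHi.1.const_smul ε), ?_, ?_⟩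
    · have := memLp_add_smul (-ε) hvi.2.1 hHi.2.1
      refine this.congr_norm ?_ ?_
      · exact (hvi.1.sub (hHi.1.const_smul ε)).continuous.aestronglyMeasurable
      · exact Eventually.of_forall fun x => by simp [hu, sub_eq_add_neg]
    · rw [funext hfdu]; exact memLp_add_smul (-ε) hvi.2.2 hHi.2.2
  have hucont := hui.1.continuous
  have hvcont := hvi.1.continuous
  set ψ : E2 → E2 := fun x => χ x • u x with hψ
  have hψi : MemH1 ψ := memH1_smul hui hχ hχc
  have hψc : HasCompactSupport ψ := hχc.smul_right
  have hψcont := hψi.1.continuous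
  have hχcont := hχ.continuous
  have hχd : Differentiable ℝ χ := hχ.differentiable (by simp)
  have hEL := weak_EL hμ hf hmin hEdens hψi.1 hψc hψi.2.2
  -- pieces
  have hz : ∀ g : E2 → ℝ, Continuous g → (∀ x, χ x = 0 → g x = 0) → Integrable g := by
    intro g hg h0
    apply hg.integrable_of_hasCompactSupport
    exact hχc.mono (fun x hx hx0 => hx (h0 x hx0))
  have hlapc := continuous_lap hH
  have hlapSc := continuous_lapS hχ
  have hGu : Integrable (gradSq u) := by
    unfold gradSq
    exact integrable_finsetSum _ fun i _ => integrable_normsq_of_memLp (memLp_pd hui.2.2 i)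
  have g1 : Integrable (fun x => χ x * gradSq u x) :=
    hGu.locallyIntegrable.integrable_smul_left_of_hasCompactSupport hχcont hχc
  have hqi : ∀ i, Integrable (fun x => fderiv ℝ (fun y => ‖u y‖^2) x (e2basis i)) := by
    intro i
    simp_rw [fderiv_normsq hui.1]
    exact (integrable_inner_of_memLp (memLp_pd hui.2.2 i) hui.2.1).const_mul 2
  have hqd : Differentiable ℝ (fun y => ‖u y‖^2) := hui.1.norm_sq ℝ
  have hB := ibp_lapS hqd (fun i => (hqi i).locallyIntegrable) hχ hχc
  set G2 : E2 → ℝ := fun x => ∑ i : Fin 2, fderiv ℝ χ x (e2basis i) * fderiv ℝ (fun y => ‖u y‖^2) x (e2basis i)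
    with hG2
  have g2 : Integrable G2 := by
    refine integrable_finsetSum _ fun i _ => ?_
    exact (hqi i).locallyIntegrable.integrable_smul_left_of_hasCompactSupport
      (contDiff_pd hχ _).continuous (hcs_pd hχc _)
  have g3 : Integrable (gradInner H ψ) := by
    unfold gradInner
    exact integrable_finsetSum _ fun i _ => integrable_inner_of_memLp (memLp_pd hHi.2.2 i) (memLp_pd hψi.2.2 i)
  have hA := ibp_A hH hHc hψi
  set Z : E2 → ℝ := fun x => -(1/ε^2) * μ x * (inner ℝ (v x) (ψ x) : ℝ)
      + (1/ε^2) * ‖v x‖^2 * (inner ℝ (v x) (ψ x) : ℝ) - (a/ε) * (inner ℝ (f x) (ψ x) : ℝ) with hZ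
  have z1 : Integrable Z := by
    refine hz _ ?_ ?_
    · fun_prop
    · intro x hx; simp [hZ, hψ, hx]
  have hl1 : Integrable (fun x => (inner ℝ (lap H x) (ψ x) : ℝ)) := by
    refine hz _ ?_ ?_
    · fun_prop
    · intro x hx; simp [hψ, hx]
  have hsplit : ∀ x, (gradInner v ψ x - (1/ε^2) * μ x * (inner ℝ (v x) (ψ x) : ℝ)
      + (1/ε^2) * ‖v x‖^2 * (inner ℝ (v x) (ψ x) : ℝ) - (a/ε) * (inner ℝ (f x) (ψ x) : ℝ)) =
      ((χ x * gradSq u x + (1/2) * G2 x) + ε * gradInner H ψ x) + Z x := by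
    intro x
    have hfψ : ∀ e, fderiv ℝ ψ x e = χ x • fderiv ℝ u x e + (fderiv ℝ χ x e) • u x := by
      intro e
      have := ((hχd x).hasFDerivAt.smul (hui.1 x).hasFDerivAt).fderiv
      have h2 : fderiv ℝ ψ x = χ x • fderiv ℝ u x + (fderiv ℝ χ x).smulRight (u x) := this
      rw [h2]; simp
    have hfv : ∀ e, fderiv ℝ v x e = fderiv ℝ u x e + ε • fderiv ℝ H x e := by
      intro e; rw [hfdu]; simp
    have hgi : gradInner v ψ x = χ x * gradSq u x + (1/2) * G2 x + ε * gradInner H ψ x := by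
      simp only [gradInner, gradSq, hG2, fderiv_normsq hui.1, Fin.sum_univ_two, hfv, hfψ,
        inner_add_left, inner_add_right, inner_smul_left, inner_smul_right, conj_trivial,
        real_inner_self_eq_norm_sq]
      ring
    rw [hgi, hZ]; ring
  have hsum : (∫ x, χ x * gradSq u x) + (1/2) * (∫ x, G2 x) + ε * (∫ x, gradInner H ψ x)
      + ∫ x, Z x = 0 := by
    rw [← hEL]
    simp_rw [hsplit]
    have g2' := g2.const_mul (1/2)
    have g3' := g3.const_mul ε
    have s1 : Integrable (fun x => χ x * gradSq u x + (1/2) * G2 x) := g1.add g2'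
    have s2 : Integrable (fun x => χ x * gradSq u x + (1/2) * G2 x + ε * gradInner H ψ x) := s1.add g3'
    rw [integral_add s2 z1, integral_add s1 g3', integral_add g1 g2', integral_const_mul, integral_const_mul]
  have hpos : 0 ≤ ∫ x, χ x * gradSq u x :=
    integral_nonneg fun x => mul_nonneg (hχ0 x) (Finset.sum_nonneg fun i _ => sq_nonneg _)
  have hi1 : Integrable (fun x => χ x * ‖u x‖^2) := by
    refine hz _ ?_ ?_
    · fun_prop
    · intro x hx; simp [hx]
  have hi2 : Integrable χ := hz _ hχcont fun x hx => hx
  have hW : (c/2) * (∫ x, χ x * ‖u x‖^2) - ε^6 * M^2/(2*c) * (∫ x, χ x) ≤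
      ε^2 * (-ε * (∫ x, (inner ℝ (lap H x) (ψ x) : ℝ)) + ∫ x, Z x) := by
    have hl1' := hl1.const_mul (-ε)
    rw [← integral_const_mul, ← integral_const_mul, ← integral_const_mul,
      ← integral_sub (hi1.const_mul _) (hi2.const_mul _), ← integral_add hl1' z1, ← integral_const_mul]
    refine integral_mono ((hi1.const_mul _).sub (hi2.const_mul _)) ((hl1'.add z1).const_mul _) fun x => ?_
    by_cases hx : x ∈ S
    · have := pointwise_W hε hc (hχ0 x) (hS x hx) (v := v x) (l := lap H x) (hHeq x hx) (hHM x hx)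
      simp only [hZ, hψ, hu]
      linarith
    · have h0 := hχS x hx
      simp [hZ, hψ, h0]
  rw [hA, hB] at hsum
  have e2 : 0 < ε^2 := by positivity
  have hfin : ε^2 * (-ε * (∫ x, (inner ℝ (lap H x) (ψ x) : ℝ)) + ∫ x, Z x) ≤
      ε^2 * ((1/2) * ∫ x, lapS χ x * ‖u x‖^2) := by
    apply mul_le_mul_of_nonneg_left _ e2.le
    linarith
  have : (M^2/c) * ε^6 * (∫ x, χ x) = 2 * (ε^6 * M^2/(2*c) * (∫ x, χ x)) := by
    field_simp
  rw [this]
  linarith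

/-- smooth increasing profile, 0 below `η`, 1 above `2η` -/
def prof (η t : ℝ) : ℝ := smoothTransition (t / η - 1)

lemma prof_contDiff (η : ℝ) : ContDiff ℝ (⊤ : ℕ∞) (prof η) := by
  unfold prof
  exact smoothTransition.contDiff.comp ((contDiff_id.div_const η).sub contDiff_const)

lemma prof_zero {η t : ℝ} (hη : 0 < η) (h : t ≤ η) : prof η t = 0 := by
  apply smoothTransition.zero_of_nonpos
  have : t / η ≤ 1 := (div_le_one hη).2 h
  linarith

lemma prof_one {η t : ℝ} (hη : 0 < η) (h : 2 * η ≤ t) : prof η t = 1 := by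
  apply smoothTransition.one_of_one_le
  have : 2 ≤ t / η := (le_div_iff₀ hη).2 h
  linarith

lemma prof_mono {η : ℝ} (hη : 0 < η) : Monotone (prof η) := by
  intro s t h
  apply smoothTransition.monotone
  have := div_le_div_of_nonneg_right h hη.le
  linarith

lemma dprof_nonneg {η : ℝ} (hη : 0 < η) (t : ℝ) : 0 ≤ deriv (prof η) t :=
  (prof_mono hη).deriv_nonneg

lemma dprof_continuous (η : ℝ) : Continuous (deriv (prof η)) :=
  (prof_contDiff η).continuous_deriv (by simp)

lemma dprof_zero_left {η t : ℝ} (hη : 0 < η) (h : t < η) : deriv (prof η) t = 0 := by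
  have : prof η =ᶠ[𝓝 t] fun _ => 0 := by
    filter_upwards [Iio_mem_nhds h] with s hs using prof_zero hη (le_of_lt hs)
  rw [this.deriv_eq]; simp

lemma dprof_zero_right {η t : ℝ} (hη : 0 < η) (h : 2 * η < t) : deriv (prof η) t = 0 := by
  have : prof η =ᶠ[𝓝 t] fun _ => 1 := by
    filter_upwards [Ioi_mem_nhds h] with s hs using prof_one hη (le_of_lt hs)
  rw [this.deriv_eq]; simp

lemma exists_G {η D : ℝ} (hη : 0 < η) (hD : η ≤ D) : ∃ G : ℝ → ℝ, ContDiff ℝ (⊤ : ℕ∞) G ∧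
    (∀ s, 2 * D ≤ s → G s = 0) ∧ (∀ s, 0 ≤ G s) ∧
    ∀ s, s * deriv (deriv G) s + deriv G s = -(deriv (prof η) s - deriv (prof D) s) := by
  have hD0 : 0 < D := hη.trans_le hD
  set m : ℝ → ℝ := fun t => prof η t - prof D t with hm
  have hmc : ContDiff ℝ (⊤ : ℕ∞) m := (prof_contDiff η).sub (prof_contDiff D)
  have hm0 : ∀ t, t ≤ η → m t = 0 := fun t ht => by
    simp [hm, prof_zero hη ht, prof_zero hD0 (ht.trans hD)]
  have hm1 : ∀ t, 2 * D ≤ t → m t = 0 := fun t ht => by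
    simp [hm, prof_one hη (by linarith : 2 * η ≤ t), prof_one hD0 ht]
  have hmn : ∀ t, 0 ≤ m t := by
    intro t
    by_cases ht : t ≤ η
    · rw [hm0 t ht]
    · push Not at ht
      have : prof D t ≤ prof η t := by
        apply smoothTransition.monotone
        have := div_le_div_of_nonneg_left (hη.trans ht).le hη hD
        linarith
      simp only [hm]; linarith
  set k : ℝ → ℝ := fun t => m t / t with hk
  have hkc : ContDiff ℝ (⊤ : ℕ∞) k := by
    rw [contDiff_iff_contDiffAt]
    intro t
    by_cases ht : t < η
    · have : k =ᶠ[𝓝 t] fun _ => 0 := by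
        filter_upwards [Iio_mem_nhds ht] with s hs
        simp [hk, hm0 s (le_of_lt hs)]
      exact contDiffAt_const.congr_of_eventuallyEq this
    · push Not at ht
      exact hmc.contDiffAt.div contDiffAt_id (hη.trans_le ht).ne'
  have hkn : ∀ t, 0 ≤ k t := by
    intro t
    by_cases ht : t ≤ η
    · simp [hk, hm0 t ht]
    · push Not at ht
      exact div_nonneg (hmn t) (hη.trans ht).le
  have hmk : ∀ t, m t = t * k t := by
    intro t
    by_cases ht : t = 0
    · subst ht; simp [hm0 0 hη.le]
    · simp only [hk]; field_simp
  set G : ℝ → ℝ := fun s => ∫ t in s..(2*D), k t with hG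
  have hGd : ∀ s, HasDerivAt G (-k s) s := fun s =>
    intervalIntegral.integral_hasDerivAt_left (hkc.continuous.intervalIntegrable _ _)
      hkc.continuous.stronglyMeasurable.stronglyMeasurableAtFilter hkc.continuous.continuousAt
  have hdG : deriv G = fun s => -k s := funext fun s => (hGd s).deriv
  have hGz : ∀ s, 2 * D ≤ s → G s = 0 := by
    intro s hs
    simp only [hG]
    rw [intervalIntegral.integral_symm]
    have : ∫ t in (2*D)..s, k t = ∫ t in (2*D)..s, (0:ℝ) := by
      apply intervalIntegral.integral_congr
      intro t ht
      rw [uIcc_of_le hs] at ht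
      simp [hk, hm1 t ht.1]
    rw [this]; simp
  refine ⟨G, ?_, hGz, ?_, ?_⟩
  · rw [contDiff_infty_iff_deriv]
    refine ⟨fun s => (hGd s).differentiableAt, ?_⟩
    rw [hdG]; exact hkc.neg
  · intro s
    by_cases hs : 2 * D ≤ s
    · rw [hGz s hs]
    · push Not at hs
      exact intervalIntegral.integral_nonneg hs.le fun t _ => hkn t
  · intro s
    rw [hdG]
    have hkd : HasDerivAt k (deriv k s) s := (hkc.differentiable (by simp) s).hasDerivAt
    have h1 : deriv m s = k s + s * deriv k s := by
      have h2 : m = fun t => t * k t := funext hmk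
      rw [h2]
      have h5 : deriv (fun t => t * k t) s = 1 * k s + s * deriv k s :=
        ((hasDerivAt_id s).mul hkd).deriv
      rw [h5, one_mul]
    have h3 : deriv m s = deriv (prof η) s - deriv (prof D) s :=
      deriv_fun_sub ((prof_contDiff η).differentiable (by simp) s) ((prof_contDiff D).differentiable (by simp) s)
    have h4 : deriv (fun s => -k s) s = -deriv k s := hkd.neg.deriv
    rw [h4, ← h3, h1]; ring

lemma lapS_radial {G : ℝ → ℝ} (hG : ContDiff ℝ (⊤ : ℕ∞) G) (x0 x : E2) :
    lapS (fun y => G (‖y - x0‖^2)) x =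
      4 * (‖x - x0‖^2 * deriv (deriv G) (‖x - x0‖^2) + deriv G (‖x - x0‖^2)) := by
  have hs : ∀ y, HasFDerivAt (fun y : E2 => ‖y - x0‖^2) (2 • (innerSL ℝ (y - x0))) y := by
    intro y
    have := ((hasFDerivAt_id y).sub_const x0).norm_sq
    simpa using this
  have hG' : ContDiff ℝ (⊤ : ℕ∞) (deriv G) := (contDiff_infty_iff_deriv.1 hG).2
  have h1 : ∀ y e, fderiv ℝ (fun y => G (‖y - x0‖^2)) y e =
      deriv G (‖y - x0‖^2) * (2 * (inner ℝ (y - x0) e : ℝ)) := by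
    intro y e
    have hg : HasDerivAt G (deriv G (‖y - x0‖^2)) (‖y - x0‖^2) :=
      (hG.differentiable (by simp) _).hasDerivAt
    have h7 : fderiv ℝ (fun y => G (‖y - x0‖^2)) y = _ := (hg.comp_hasFDerivAt y (hs y)).fderiv
    rw [h7]
    simp [inner_sub_left]
  have h2 : ∀ e : E2, fderiv ℝ (fun y => fderiv ℝ (fun y => G (‖y - x0‖^2)) y e) x e =
      deriv (deriv G) (‖x - x0‖^2) * (2 * (inner ℝ (x - x0) e : ℝ))^2 +
       deriv G (‖x - x0‖^2) * (2 * ‖e‖^2) := by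
    intro e
    simp_rw [h1]
    have hg : HasDerivAt (deriv G) (deriv (deriv G) (‖x - x0‖^2)) (‖x - x0‖^2) :=
      (hG'.differentiable (by simp) _).hasDerivAt
    have ha := hg.comp_hasFDerivAt x (hs x)
    have hb : HasFDerivAt (fun y : E2 => 2 * (inner ℝ (y - x0) e : ℝ)) ((2:ℝ) • (innerSL ℝ e)) x := by
      have h5 : HasFDerivAt (fun y : E2 => (inner ℝ e (y - x0) : ℝ)) (innerSL ℝ e) x :=
        (innerSL ℝ e).hasFDerivAt.comp x ((hasFDerivAt_id x).sub_const x0)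
      have h6 := h5.const_mul 2
      simpa only [real_inner_comm] using h6
    have hc := (ha.mul hb).fderiv
    have hc' : fderiv ℝ (fun y => deriv G (‖y - x0‖^2) * (2 * (inner ℝ (y - x0) e : ℝ))) x = _ := hc
    rw [hc']
    simp [inner_sub_left]
    ring
  unfold lapS
  simp only [h2, Fin.sum_univ_two]
  have n1 : ∀ i, ‖e2basis i‖ = 1 := by intro i; simp [e2basis]
  have n2 : ‖x - x0‖^2 = (inner ℝ (x - x0) (e2basis 0) : ℝ)^2 + (inner ℝ (x - x0) (e2basis 1) : ℝ)^2 := by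
    simp [e2basis, EuclideanSpace.norm_sq_eq, EuclideanSpace.inner_single_right]
  rw [n1, n1]
  have : ∀ A B S : ℝ, S = (inner ℝ (x - x0) (e2basis 0) : ℝ)^2 + (inner ℝ (x - x0) (e2basis 1) : ℝ)^2 →
    A * (2 * (inner ℝ (x - x0) (e2basis 0) : ℝ))^2 + B * (2 * 1^2) + 
     (A * (2 * (inner ℝ (x - x0) (e2basis 1) : ℝ))^2 + B * (2 * 1^2)) = 4 * (S * A + B) := by
    intro A B S h; rw [h]; ring
  exact this _ _ _ n2

lemma integral_lapS_mul {p χ : E2 → ℝ} (hp : ContDiff ℝ (⊤ : ℕ∞) p)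
    (hg : ContDiff ℝ (⊤ : ℕ∞) χ) (hgc : HasCompactSupport χ) :
    ∫ x, lapS χ x * p x = ∫ x, χ x * lapS p x := by
  have h1 := ibp_lapS (hp.differentiable (by simp))
    (fun i => (contDiff_pd hp (e2basis i)).continuous.locallyIntegrable) hg hgc
  have h2 : ∫ x, χ x * lapS p x = 
      - ∫ x, ∑ i : Fin 2, fderiv ℝ χ x (e2basis i) * fderiv ℝ p x (e2basis i) := by
    simp only [lapS, Finset.mul_sum]
    rw [integral_finsetSum, integral_finsetSum, ← Finset.sum_neg_distrib]
    · refine Finset.sum_congr rfl fun i _ => ?_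
      exact ibp_gen (p := fun y => fderiv ℝ p y (e2basis i)) ((contDiff_pd hp _).differentiable (by simp))
        (contDiff_pd (contDiff_pd hp _) _).continuous.locallyIntegrable hg hgc
    · exact fun i _ => ((contDiff_pd hg _).continuous.mul (contDiff_pd hp _).continuous).integrable_of_hasCompactSupport
        (HasCompactSupport.mul_right (hcs_pd hgc _))
    · exact fun i _ => (hg.continuous.mul (contDiff_pd (contDiff_pd hp _) _).continuous).integrable_of_hasCompactSupport
        hgc.mul_right
  rw [h2, h1, neg_neg]

/-- radial function with compact support -/
lemma hcs_radial {g : ℝ → ℝ} {A : ℝ} (h : ∀ s, A < s → g s = 0) (x0 : E2) :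
    HasCompactSupport (fun x : E2 => g (‖x - x0‖^2)) := by
  apply HasCompactSupport.intro (isCompact_closedBall x0 (√|A|))
  intro x hx
  apply h
  rw [mem_closedBall_iff_norm, not_le] at hx
  have h1 := Real.sq_sqrt (abs_nonneg A)
  have h2 := Real.sqrt_nonneg |A|
  have h3 := le_abs_self A
  nlinarith

lemma submean {D : ℝ} (hD : 0 < D) : ∃ κ L : ℝ, 0 < κ ∧ 0 ≤ L ∧ ∀ (x0 : E2) (q : E2 → ℝ) (K : ℝ),
    Continuous q → (∀ x, 0 ≤ q x) → 0 ≤ K →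
    (∀ χ : E2 → ℝ, ContDiff ℝ (⊤ : ℕ∞) χ → HasCompactSupport χ → (∀ x, 0 ≤ χ x) →
      (∀ x, 2 * D < ‖x - x0‖^2 → χ x = 0) → -∫ x, lapS χ x * q x ≤ K * ∫ x, χ x) →
    κ * q x0 ≤ L * (∫ x in {x : E2 | ‖x - x0‖^2 ≤ 2 * D}, q x) + D * κ * K := by
  set κ : ℝ := ∫ x : E2, deriv (prof D) (‖x‖^2) with hκ
  have hdc := fun η => dprof_continuous η
  have hκpos : 0 < κ := by
    have hc : Continuous (fun x : E2 => deriv (prof D) (‖x‖^2)) := (hdc D).comp (by fun_prop)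
    have hcs : HasCompactSupport (fun x : E2 => deriv (prof D) (‖x‖^2)) := by
      simpa using hcs_radial (fun s hs => dprof_zero_right hD hs) (0 : E2)
    have hex : ∃ t, deriv (prof D) t ≠ 0 := by
      by_contra hcon
      push Not at hcon
      have := is_const_of_deriv_eq_zero ((prof_contDiff D).differentiable (by simp)) hcon D (2*D)
      rw [prof_zero hD le_rfl, prof_one hD le_rfl] at this
      norm_num at this
    obtain ⟨t, ht⟩ := hex
    have ht0 : 0 ≤ t := by
      by_contra hcon
      push Not at hcon
      exact ht (dprof_zero_left hD (hcon.trans hD))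
    refine hc.integral_pos_of_hasCompactSupport_nonneg_nonzero hcs (fun x => dprof_nonneg hD _)
      (x := √t • e2basis 0) ?_
    have : ‖√t • e2basis 0‖^2 = t := by
      rw [norm_smul, mul_pow]; simp [e2basis, Real.sq_sqrt ht0]
    rw [this]; exact ht
  obtain ⟨L, hL⟩ : ∃ L, ∀ t ∈ Icc 0 (2*D), ‖deriv (prof D) t‖ ≤ L :=
    isCompact_Icc.exists_bound_of_continuousOn (hdc D).continuousOn
  have hL0 : 0 ≤ L := (norm_nonneg _).trans (hL 0 ⟨le_rfl, by linarith⟩)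
  refine ⟨κ, L, hκpos, hL0, ?_⟩
  intro x0 q K hq hq0 hK hyp
  set B : Set E2 := {x : E2 | ‖x - x0‖^2 ≤ 2 * D} with hB
  apply le_of_forall_pos_le_add
  intro τ' hτ'
  set τ := τ' / κ with hτ
  have hτ0 : 0 < τ := div_pos hτ' hκpos
  obtain ⟨δ, hδ, hδq⟩ := Metric.continuousAt_iff.1 (hq.continuousAt (x := x0)) τ hτ0
  set η := min D (δ^2/4) with hη
  have hη0 : 0 < η := lt_min hD (by positivity)
  have hηD : η ≤ D := min_le_left _ _
  have hηδ : η ≤ δ^2/4 := min_le_right _ _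
  obtain ⟨G, hG, hGz, hGn, hGe⟩ := exists_G hη0 hηD
  set χ : E2 → ℝ := fun x => G (‖x - x0‖^2) with hχ
  have hsm : ContDiff ℝ (⊤ : ℕ∞) (fun x : E2 => ‖x - x0‖^2) :=
    (contDiff_id.sub contDiff_const).norm_sq ℝ
  have hχs : ContDiff ℝ (⊤ : ℕ∞) χ := hG.comp hsm
  have hχc : HasCompactSupport χ := hcs_radial (fun s hs => hGz s (le_of_lt hs)) x0
  have hlap : ∀ x, lapS χ x = -4 * (deriv (prof η) (‖x - x0‖^2) - deriv (prof D) (‖x - x0‖^2)) := by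
    intro x
    rw [hχ, lapS_radial hG, hGe]; ring
  -- integrability of kernels
  have kcont : ∀ η, Continuous (fun x : E2 => deriv (prof η) (‖x - x0‖^2)) := fun η =>
    (hdc η).comp hsm.continuous
  have kcs : ∀ η, 0 < η → HasCompactSupport (fun x : E2 => deriv (prof η) (‖x - x0‖^2)) := fun η hη =>
    hcs_radial (fun s hs => dprof_zero_right hη hs) x0
  have kint : ∀ η, 0 < η → ∀ g : E2 → ℝ, Continuous g →
      Integrable (fun x : E2 => deriv (prof η) (‖x - x0‖^2) * g x) := fun η hη g hg =>
    ((kcont η).mul hg).integrable_of_hasCompactSupport (kcs η hη).mul_right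
  have hdiff : ∀ g : E2 → ℝ, Continuous g → ∫ x, lapS χ x * g x =
      -4 * ((∫ x, deriv (prof η) (‖x - x0‖^2) * g x) - ∫ x, deriv (prof D) (‖x - x0‖^2) * g x) := by
    intro g hg
    rw [← integral_sub (kint η hη0 g hg) (kint D hD g hg), ← integral_const_mul]
    congr 1; funext x; rw [hlap]; ring
  have hκ' : ∫ x, deriv (prof D) (‖x - x0‖^2) = κ := by
    rw [hκ]
    exact integral_sub_right_eq_self (fun x : E2 => deriv (prof D) (‖x‖^2)) x0
  have hκη : ∫ x, deriv (prof η) (‖x - x0‖^2) = κ := by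
    have h1 := integral_lapS_mul (p := fun _ => (1:ℝ)) contDiff_const hχs hχc
    have h2 : ∀ x, lapS (fun _ : E2 => (1:ℝ)) x = 0 := by intro x; simp [lapS]
    rw [hdiff _ continuous_const] at h1
    simp only [h2, mul_one, mul_zero, integral_zero] at h1
    linarith
  have hχint : ∫ x, χ x ≤ 2 * D * κ := by
    have h1 := integral_lapS_mul hsm hχs hχc
    have h2 : ∀ x, lapS (fun x : E2 => ‖x - x0‖^2) x = 4 := by
      intro x
      have h3 := lapS_radial (G := fun t => t) contDiff_fun_id x0 x
      rw [h3]
      have h4 : deriv (fun t : ℝ => t) = fun _ => 1 := by funext t; simp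
      rw [h4]; simp
    rw [hdiff _ hsm.continuous] at h1
    simp only [h2] at h1
    rw [integral_mul_const] at h1
    have h5 : 0 ≤ ∫ x, deriv (prof η) (‖x - x0‖^2) * ‖x - x0‖^2 :=
      integral_nonneg fun x => mul_nonneg (dprof_nonneg hη0 _) (sq_nonneg _)
    have h6 : ∫ x, deriv (prof D) (‖x - x0‖^2) * ‖x - x0‖^2 ≤ ∫ x, deriv (prof D) (‖x - x0‖^2) * (2 * D) := by
      refine integral_mono (kint D hD _ hsm.continuous) (kint D hD _ continuous_const) fun x => ?_
      by_cases hx : 2 * D < ‖x - x0‖^2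
      · simp [dprof_zero_right hD hx]
      · push Not at hx
        exact mul_le_mul_of_nonneg_left hx (dprof_nonneg hD _)
    rw [integral_mul_const, hκ'] at h6
    linarith
  have hy := hyp χ hχs hχc (fun x => hGn _) (fun x hx => hGz _ hx.le)
  rw [hdiff q hq] at hy
  have hK2 := mul_le_mul_of_nonneg_left hχint hK
  have low : κ * (q x0 - τ) ≤ ∫ x, deriv (prof η) (‖x - x0‖^2) * q x := by
    rw [← hκη, ← integral_mul_const]
    refine integral_mono (kint η hη0 _ continuous_const) (kint η hη0 _ hq) fun x => ?_
    by_cases hx : 2 * η < ‖x - x0‖^2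
    · simp [dprof_zero_right hη0 hx]
    · push Not at hx
      refine mul_le_mul_of_nonneg_left ?_ (dprof_nonneg hη0 _)
      have hlt : ‖x - x0‖ < δ := by
        have h0 : ‖x - x0‖^2 < δ^2 := by nlinarith
        exact lt_of_pow_lt_pow_left₀ 2 hδ.le h0
      have := hδq (x := x) (by rwa [dist_eq_norm])
      rw [Real.dist_eq, abs_lt] at this
      linarith [this.1]
  have hBc : IsCompact B := by
    have : B = Metric.closedBall x0 (√(2*D)) := by
      ext x
      rw [mem_closedBall_iff_norm, hB, mem_setOf_eq, Real.le_sqrt (norm_nonneg _) (by positivity)]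
    rw [this]; exact isCompact_closedBall _ _
  have up : ∫ x, deriv (prof D) (‖x - x0‖^2) * q x ≤ L * ∫ x in B, q x := by
    rw [← integral_const_mul, ← integral_indicator hBc.measurableSet]
    refine integral_mono (kint D hD _ hq) ?_ fun x => ?_
    · rw [integrable_indicator_iff hBc.measurableSet]
      exact (continuous_const.mul hq).continuousOn.integrableOn_compact hBc
    · by_cases hx : x ∈ B
      · rw [indicator_of_mem hx]
        exact mul_le_mul_of_nonneg_right ((le_abs_self _).trans (hL _ ⟨sq_nonneg _, hx⟩)) (hq0 x)
      · rw [indicator_of_notMem hx]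
        have : 2 * D < ‖x - x0‖^2 := by
          by_contra hc; exact hx (not_lt.1 hc)
        simp [dprof_zero_right hD this]
  have hτκ : κ * τ = τ' := by rw [hτ]; field_simp
  have hpos : 0 ≤ D * κ * K := by positivity
  nlinarith

lemma mu_strictAnti {μ : E2 → ℝ} {μrad : ℝ → ℝ} {ρ : ℝ} (hμ : MuHyp μ μrad ρ) :
    StrictAntiOn μrad (Ici 0) := by
  apply strictAntiOn_of_deriv_neg (convex_Ici 0) hμ.smooth_rad.continuous.continuousOn
  intro r hr
  rw [interior_Ici] at hr
  exact hμ.deriv_neg r hr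

lemma integrable_edens {μ : E2 → ℝ} {μrad : ℝ → ℝ} {ρ : ℝ} (hμ : MuHyp μ μrad ρ)
    {f : E2 → E2} (hf : Continuous f) : ∃ ε1 : ℝ, 0 < ε1 ∧ ∀ ε a : ℝ, ∀ v, 0 < ε → ε < ε1 →
      IsMinimizer ε a μ f v → Integrable (edens ε a μ f v) := by
  have hρ := hμ.rho_pos
  have hμc := hμ.smooth.continuous
  let b : ContDiffBump (0 : E2) := ⟨ρ/4, ρ/2, by linarith, by linarith⟩
  set φ : E2 → E2 := fun x => b x • e2basis 0 with hφ
  have hφs : ContDiff ℝ (⊤ : ℕ∞) φ := b.contDiff.smul contDiff_const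
  have hφc : HasCompactSupport φ := b.hasCompactSupport.smul_right
  have hφi := memH1_smooth hφs hφc
  have hφcont := hφs.continuous
  have hnorm : ∀ x, ‖φ x‖ = b x := by
    intro x
    simp [hφ, norm_smul, e2basis, abs_of_nonneg b.nonneg]
  have hz : ∀ g : E2 → ℝ, Continuous g → (∀ x, φ x = 0 → g x = 0) → Integrable g := by
    intro g hg h0
    apply hg.integrable_of_hasCompactSupport
    exact hφc.mono (fun x hx hx0 => hx (h0 x hx0))
  have iA : Integrable (gradSq φ) := by
    unfold gradSq
    exact integrable_finsetSum _ fun i _ => integrable_normsq_of_memLp (memLp_pd hφi.2.2 i)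
  have iB : Integrable (fun x => μ x * ‖φ x‖^2) := hz _ (by fun_prop) (fun x hx => by simp [hx])
  have iD : Integrable (fun x => ‖φ x‖^4) := hz _ (by fun_prop) (fun x hx => by simp [hx])
  have iF : Integrable (fun x => (inner ℝ (f x) (φ x) : ℝ)) := hz _ (by fun_prop) (fun x hx => by simp [hx])
  set A := ∫ x, gradSq φ x with hA
  set B := ∫ x, μ x * ‖φ x‖^2 with hB
  set Q := ∫ x, ‖φ x‖^4 with hQ
  set F := ∫ x, (inner ℝ (f x) (φ x) : ℝ) with hF
  have hA0 : 0 ≤ A := integral_nonneg fun x => Finset.sum_nonneg fun i _ => sq_nonneg _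
  have hQ0 : 0 ≤ Q := integral_nonneg fun x => by positivity
  have hμpos : ∀ r, 0 ≤ r → r < ρ → 0 < μrad r := by
    intro r h0 h1
    have := mu_strictAnti hμ (mem_Ici.2 h0) (mem_Ici.2 hρ.le) h1
    rwa [hμ.rho_root] at this
  have hB0 : 0 < B := by
    have hc : Continuous (fun x => μ x * ‖φ x‖^2) := by fun_prop
    refine hc.integral_pos_of_hasCompactSupport_nonneg_nonzero
      (hφc.mono (fun x hx hx0 => hx (by simp only [hx0]; simp))) ?_ (x := 0) ?_
    · intro x
      by_cases hx : ‖x‖ < ρ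
      · exact mul_nonneg (by rw [hμ.radial]; exact (hμpos _ (norm_nonneg _) hx).le) (sq_nonneg _)
      · push Not at hx
        have : b x = 0 := b.zero_of_le_dist (by
          rw [dist_zero_right]; exact (by linarith : ρ/2 ≤ ρ).trans hx)
        simp [hnorm, this]
    · have h1 : b 0 = 1 := b.one_of_mem_closedBall (by
        simp [b.rIn_pos.le])
      rw [hnorm, h1, hμ.radial]
      simpa using (hμpos 0 le_rfl hρ).ne'
  refine ⟨min 1 (B/(2*A+1)), lt_min one_pos (by positivity), ?_⟩
  intro ε a v hε hε1 hmin
  by_contra hni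
  have hv0 : energy ε a μ f v = 0 := integral_undef hni
  -- choose s
  set s0 := √(B/(Q+1)) with hs0
  have hs0sq : s0^2 = B/(Q+1) := Real.sq_sqrt (by positivity)
  obtain ⟨s, hs2, hsF⟩ : ∃ s : ℝ, s^2 = B/(Q+1) ∧ 0 ≤ (a/ε) * (s * F) := by
    by_cases h : 0 ≤ (a/ε) * (s0 * F)
    · exact ⟨s0, hs0sq, h⟩
    · refine ⟨-s0, by rw [neg_sq, hs0sq], ?_⟩
      push Not at h
      linarith
  have hle := hmin.2 (fun x => s • φ x) (memH1_smooth (hφs.const_smul s) (hφc.smul_left (f := fun _ => s)))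
  rw [hv0] at hle
  have hE : energy ε a μ f (fun x => s • φ x) = (1/2) * s^2 * A - (1/(2*ε^2)) * s^2 * B
      + (1/(4*ε^2)) * s^4 * Q - (a/ε) * (s * F) := by
    have hfd : ∀ x, fderiv ℝ (fun y => s • φ y) x = s • fderiv ℝ φ x := fun x =>
      ((hφi.1 x).hasFDerivAt.const_smul s).fderiv
    have hpt : ∀ x, ((1/2) * gradSq (fun x => s • φ x) x - (1/(2*ε^2)) * μ x * ‖s • φ x‖^2
    + (1/(4*ε^2)) * ‖s • φ x‖^4 - (a/ε) * (inner ℝ (f x) (s • φ x) : ℝ)) =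
      ((1/2) * s^2) * gradSq φ x - ((1/(2*ε^2)) * s^2) * (μ x * ‖φ x‖^2)
      + ((1/(4*ε^2)) * s^4) * ‖φ x‖^4 - ((a/ε) * s) * (inner ℝ (f x) (φ x) : ℝ) := by
      intro x
      simp only [gradSq, hfd, Fin.sum_univ_two, _root_.smul_apply, norm_smul, mul_pow,
        inner_smul_right, Real.norm_eq_abs, sq_abs]
      have : |s|^4 = s^4 := by
        rw [show (4:ℕ) = 2*2 from rfl, pow_mul, sq_abs, ← pow_mul]
      rw [this]; ring
    unfold energy
    simp_rw [hpt]
    have i1 := iA.const_mul ((1/2) * s^2)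
    have i2 := iB.const_mul ((1/(2*ε^2)) * s^2)
    have i3 := iD.const_mul ((1/(4*ε^2)) * s^4)
    have i4 := iF.const_mul ((a/ε) * s)
    have i12 : Integrable (fun x => ((1/2) * s^2) * gradSq φ x - ((1/(2*ε^2)) * s^2) * (μ x * ‖φ x‖^2)) := i1.sub i2
    have i123 : Integrable (fun x => ((1/2) * s^2) * gradSq φ x - ((1/(2*ε^2)) * s^2) * (μ x * ‖φ x‖^2)
      + ((1/(4*ε^2)) * s^4) * ‖φ x‖^4) := i12.add i3
    rw [integral_sub i123 i4, integral_add i12 i3, integral_sub i1 i2, integral_const_mul,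
      integral_const_mul, integral_const_mul, integral_const_mul]
    ring
  rw [hE] at hle
  have hs4 : s^4 * Q ≤ s^2 * B := by
    have h1 : s^2 * Q ≤ B := by
      rw [hs2, div_mul_eq_mul_div, div_le_iff₀ (by positivity)]
      nlinarith
    calc s^4 * Q = s^2 * (s^2 * Q) := by ring
      _ ≤ s^2 * B := mul_le_mul_of_nonneg_left h1 (sq_nonneg _)
  have hspos : 0 < s^2 := by rw [hs2]; positivity
  have hεlt1 : ε < 1 := hε1.trans_le (min_le_left _ _)
  have hεB : ε * (2*A+1) < B := by
    have := hε1.trans_le (min_le_right _ _)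
    rwa [lt_div_iff₀ (by positivity)] at this
  have hkey : 2 * ε^2 * A < B := by nlinarith [mul_nonneg hε.le hA0]
  have : 0 ≤ (4 * ε^2) * ((1/2) * s^2 * A - (1/(2*ε^2)) * s^2 * B + (1/(4*ε^2)) * s^4 * Q) := by
    apply mul_nonneg (by positivity); linarith
  have h2 : (4 * ε^2) * ((1/2) * s^2 * A - (1/(2*ε^2)) * s^2 * B + (1/(4*ε^2)) * s^4 * Q) =
      s^2 * (2 * ε^2 * A) - 2 * (s^2 * B) + s^4 * Q := by
    field_simp; ring
  rw [h2] at this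
  nlinarith [mul_lt_mul_of_pos_left hkey hspos]

lemma L2_bound {μ : E2 → ℝ} {μrad : ℝ → ℝ} {ρ : ℝ} (hμ : MuHyp μ μrad ρ)
    {f : E2 → E2} {frad : ℝ → ℝ} (hf : FHyp f frad) (A : ℝ) : ∃ C0 : ℝ, ∀ ε a : ℝ, ∀ v, 0 < ε → ε ≤ 1 →
      0 ≤ a → a ≤ A → 
      IsMinimizer ε a μ f v → Integrable (edens ε a μ f v) → ∫ x, ‖v x‖^2 ≤ C0 := by
  have hρ := hμ.rho_pos
  obtain ⟨Cμ, hCμ⟩ := hμ.bdd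
  obtain ⟨Cf, hCf⟩ := hf.bdd
  have hCf0 : 0 ≤ Cf := (norm_nonneg _).trans (hCf 0)
  have hCμ0 : 0 ≤ Cμ := (abs_nonneg _).trans (hCμ 0)
  set R := ρ + 1 with hR
  set c := -μrad R with hc
  have hc0 : 0 < c := by
    have := mu_strictAnti hμ (mem_Ici.2 hρ.le) (mem_Ici.2 (by linarith : 0 ≤ R)) (by linarith : ρ < R)
    rw [hμ.rho_root] at this
    linarith
  have hout : ∀ x : E2, R ≤ ‖x‖ → μ x ≤ -c := by
    intro x hx
    rw [hμ.radial, hc, neg_neg]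
    exact (mu_strictAnti hμ).antitoneOn (mem_Ici.2 (by linarith : 0 ≤ R)) (mem_Ici.2 (norm_nonneg _)) hx
  set N := (Cμ/2 + 3/2)^2 + A^2 * Cf^2/2 with hN
  set g : E2 → ℝ := fun x => (A^2 * Cf/c) * ‖f x‖ + (Metric.ball (0:E2) R).indicator (fun _ => N) x with hg
  have hgi : Integrable g := by
    refine (hf.integrable.norm.const_mul _).add ?_
    rw [integrable_indicator_iff measurableSet_ball]
    exact integrableOn_const (measure_ball_lt_top.ne)
  set c1 := min (c/4) 1 with hc1
  have hc10 : 0 < c1 := lt_min (by linarith) one_pos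
  refine ⟨(∫ x, g x)/c1, ?_⟩
  intro ε a v hε hε1 ha haA hmin hEdens
  have hA0 : 0 ≤ A := ha.trans haA
  rw [le_div_iff₀ hc10]
  have h0 : ∫ x, edens ε a μ f v x ≤ 0 := by
    have h1 := hmin.2 (fun _ => 0) (memH1_smooth contDiff_const HasCompactSupport.zero)
    have h2 : energy ε a μ f (fun _ => 0) = 0 := by
      simp [energy, gradSq]
    rw [h2] at h1
    exact h1
  have hvi := integrable_normsq_of_memLp hmin.1.2.1
  have hpt : ∀ x, c1 * ‖v x‖^2 - g x ≤ ε^2 * edens ε a μ f v x := by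
    intro x
    have hgr : 0 ≤ gradSq v x := Finset.sum_nonneg fun i _ => sq_nonneg _
    have hex : ε^2 * edens ε a μ f v x = (1/2) * ε^2 * gradSq v x - (1/2) * μ x * ‖v x‖^2
        + (1/4) * ‖v x‖^4 - ε * a * (inner ℝ (f x) (v x) : ℝ) := by
      unfold edens; field_simp
    have hin : ε * a * (inner ℝ (f x) (v x) : ℝ) ≤ A * ‖f x‖ * ‖v x‖ := by
      have h1 : (inner ℝ (f x) (v x) : ℝ) ≤ ‖f x‖ * ‖v x‖ := real_inner_le_norm _ _
      have h2 : ε * a ≤ A := by nlinarith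
      have h3 : 0 ≤ ε * a := by positivity
      have h4 : 0 ≤ ‖f x‖ * ‖v x‖ := by positivity
      nlinarith
    have hG : 0 ≤ (1/2) * ε^2 * gradSq v x := by positivity
    rw [hex]
    set t := ‖v x‖ with ht
    set F := ‖f x‖ with hF
    have ht0 : 0 ≤ t := norm_nonneg _
    have hF0 : 0 ≤ F := norm_nonneg _
    have hFC : F ≤ Cf := hCf x
    have hμx := abs_le.1 (hCμ x)
    by_cases hx : R ≤ ‖x‖
    · have hgx : g x = (A^2 * Cf/c) * F := by
        simp only [hg]
        rw [indicator_of_notMem (by simpa using hx), add_zero]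
      have hm := hout x hx
      rw [hgx]
      have h1 : A * F * t ≤ (c/4) * t^2 + (A^2 * F^2/c) := by
        have : (c/4) * t^2 + (A^2 * F^2/c) - A * F * t = (c * t - 2 * (A * F))^2/(4*c) := by
          field_simp; ring
        have h0 : 0 ≤ (c * t - 2 * (A * F))^2/(4*c) := by positivity
        linarith
      have h2 : A^2 * F^2/c ≤ (A^2 * Cf/c) * F := by
        rw [div_mul_eq_mul_div]
        apply div_le_div_of_nonneg_right _ hc0.le
        nlinarith [mul_nonneg (sq_nonneg A) (mul_nonneg hF0 (sub_nonneg.2 hFC))]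
      have h3 : c1 * t^2 ≤ (c/4) * t^2 := mul_le_mul_of_nonneg_right (min_le_left _ _) (sq_nonneg _)
      have h4 : c * t^2 ≤ - μ x * t^2 := mul_le_mul_of_nonneg_right (by linarith) (sq_nonneg _)
      have h5 : 0 ≤ t^4 := by positivity
      linarith
    · push Not at hx
      have hgx : g x = (A^2 * Cf/c) * F + N := by
        simp only [hg]
        rw [indicator_of_mem (by simpa using hx)]
      rw [hgx]
      have h1 : 0 ≤ (A^2 * Cf/c) * F := by positivity
      have h3 : c1 * t^2 ≤ 1 * t^2 := mul_le_mul_of_nonneg_right (min_le_right _ _) (sq_nonneg _)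
      have h4 : μ x * t^2 ≤ Cμ * t^2 := mul_le_mul_of_nonneg_right hμx.2 (sq_nonneg _)
      have h5 : A * F * t ≤ t^2/2 + A^2 * Cf^2/2 := by
        have : A * F ≤ A * Cf := mul_le_mul_of_nonneg_left hFC hA0
        nlinarith [sq_nonneg (t - A * Cf), mul_le_mul_of_nonneg_right this ht0]
      have h6 : 0 ≤ (t^2/2 - (Cμ/2 + 3/2))^2 := sq_nonneg _
      have h7 : (t^2/2 - (Cμ/2 + 3/2))^2 = t^4/4 - (Cμ/2+3/2)*t^2 + (Cμ/2 + 3/2)^2 := by ring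
      rw [hN]
      linarith
  have hI := integral_mono ((hvi.const_mul c1).sub hgi) (hEdens.const_mul (ε^2)) hpt
  rw [integral_const_mul] at hI
  have hI2 : ∫ x, (((fun x => c1 * ‖v x‖^2) - g) x) = c1 * (∫ x, ‖v x‖^2) - ∫ x, g x := by
    rw [← integral_const_mul]; exact integral_sub (hvi.const_mul c1) hgi
  have hI3 : c1 * (∫ x, ‖v x‖^2) - ∫ x, g x ≤ ε^2 * ∫ x, edens ε a μ f v x := hI2 ▸ hI
  nlinarith [mul_nonneg (sq_nonneg ε) (neg_nonneg.2 h0)]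

open scoped Manifold ContDiff in
lemma exists_cutoff {s t : Set E2} (hs : IsClosed s) (ht : IsClosed t) (hd : Disjoint s t) :
    ∃ φ : E2 → ℝ, ContDiff ℝ (⊤ : ℕ∞) φ ∧ (∀ x ∈ s, φ x = 0) ∧ (∀ x ∈ t, φ x = 1) ∧ 
      ∀ x, 0 ≤ φ x ∧ φ x ≤ 1 := by
  obtain ⟨φ, h0, h1, h2⟩ := exists_contMDiffMap_zero_one_of_isClosed (n := (⊤ : ℕ∞)) 𝓘(ℝ, E2) hs ht hd
  exact ⟨φ, φ.contMDiff.contDiff, fun x hx => h0 hx, fun x hx => h1 hx, fun x => h2 x⟩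

/-- closed annulus around the circle of radius `r` -/
def Ann (r d : ℝ) : Set E2 := {x | |‖x‖ - r| ≤ d}

lemma isClosed_Ann (r d : ℝ) : IsClosed (Ann r d) :=
  isClosed_le (by fun_prop) continuous_const

lemma isCompact_Ann (r d : ℝ) : IsCompact (Ann r d) := by
  refine (isCompact_closedBall (0 : E2) (r + d)).of_isClosed_subset (isClosed_Ann r d) ?_
  intro x hx
  have := (abs_le.1 (show |‖x‖ - r| ≤ d from hx)).2
  simp only [mem_closedBall_zero_iff]
  linarith

lemma cutoff_ann (r : ℝ) {α β : ℝ} (h : α < β) : ∃ (φ : E2 → ℝ) (K : ℝ), ContDiff ℝ (⊤ : ℕ∞) φ ∧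
    HasCompactSupport φ ∧ (∀ x, 0 ≤ φ x) ∧ (∀ x ∈ Ann r α, φ x = 1) ∧ (∀ x, x ∉ Ann r β → φ x = 0) ∧
    0 ≤ K ∧ (∀ x, |lapS φ x| ≤ K) ∧ (∀ x, x ∉ Ann r β → lapS φ x = 0) := by
  have hs : IsClosed {x : E2 | β ≤ |‖x‖ - r|} := isClosed_le continuous_const (by fun_prop)
  obtain ⟨φ, hφ, h0, h1, h2⟩ := exists_cutoff hs (isClosed_Ann r α) (by
    rw [Set.disjoint_left]
    intro x hx hx'
    have h1 : β ≤ |‖x‖ - r| := hx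
    have h2 : |‖x‖ - r| ≤ α := hx'
    linarith)
  have hout : ∀ x, x ∉ Ann r β → φ x = 0 := by
    intro x hx
    have : ¬ |‖x‖ - r| ≤ β := hx
    exact h0 x (show β ≤ |‖x‖ - r| by linarith [not_le.1 this])
  have hc : HasCompactSupport φ := HasCompactSupport.intro (isCompact_Ann r β) hout
  have hl0 : ∀ x, x ∉ Ann r β → lapS φ x = 0 := by
    intro x hx
    have hev : φ =ᶠ[𝓝 x] fun _ => (0 : ℝ) := by
      filter_upwards [(isClosed_Ann r β).isOpen_compl.mem_nhds hx] with y hy using hout y hy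
    unfold lapS
    refine Finset.sum_eq_zero fun i _ => ?_
    have h3 : (fun y => fderiv ℝ φ y (e2basis i)) =ᶠ[𝓝 x] fun _ => (0 : ℝ) := by
      filter_upwards [hev.fderiv (𝕜 := ℝ)] with y hy
      rw [hy]; simp
    rw [h3.fderiv_eq]; simp
  obtain ⟨K, hK⟩ := (continuous_lapS hφ).bounded_above_of_compact_support (hcs_lapS hc)
  refine ⟨φ, K, hφ, hc, fun x => (h2 x).1, h1, hout, ?_, fun x => by simpa using hK x, hl0⟩
  exact (norm_nonneg _).trans (hK 0)

lemma cutoff_step {r α β K c ε R : ℝ} {φ q : E2 → ℝ} (hφ : ContDiff ℝ (⊤ : ℕ∞) φ)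
    (hφc : HasCompactSupport φ) (hφ0 : ∀ x, 0 ≤ φ x) (hφ1 : ∀ x ∈ Ann r α, φ x = 1)
    (hK : ∀ x, |lapS φ x| ≤ K) (hl0 : ∀ x, x ∉ Ann r β → lapS φ x = 0)
    (hq : Continuous q) (hq0 : ∀ x, 0 ≤ q x) (hc : 0 ≤ c)
    (h : c * (∫ x, φ x * q x) ≤ ε^2 * (∫ x, lapS φ x * q x) + R) :
    c * (∫ x in Ann r α, q x) ≤ ε^2 * (K * ∫ x in Ann r β, q x) + R := by
  have i1 : Integrable (fun x => φ x * q x) :=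
    (hφ.continuous.mul hq).integrable_of_hasCompactSupport (HasCompactSupport.mul_right hφc)
  have i2 : Integrable (fun x => lapS φ x * q x) :=
    ((continuous_lapS hφ).mul hq).integrable_of_hasCompactSupport
      (HasCompactSupport.mul_right (hcs_lapS hφc))
  have h1 : (∫ x in Ann r α, q x) ≤ ∫ x, φ x * q x := by
    calc (∫ x in Ann r α, q x) = ∫ x in Ann r α, φ x * q x :=
          setIntegral_congr_fun (isClosed_Ann r α).measurableSet (fun x hx => by
            simp [hφ1 x hx])
      _ ≤ _ := setIntegral_le_integral i1 (Eventually.of_forall fun x => mul_nonneg (hφ0 x) (hq0 x))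
  have h2 : (∫ x, lapS φ x * q x) ≤ K * ∫ x in Ann r β, q x := by
    rw [← integral_const_mul, ← setIntegral_eq_integral_of_forall_compl_eq_zero (s := Ann r β)
      (fun x hx => by rw [hl0 x hx, zero_mul])]
    refine setIntegral_mono i2.integrableOn
      ((hq.const_mul K).continuousOn.integrableOn_compact (isCompact_Ann r β)) fun x => ?_
    exact mul_le_mul_of_nonneg_right ((le_abs_self _).trans (hK x)) (hq0 x)
  nlinarith [mul_le_mul_of_nonneg_left h1 hc, mul_le_mul_of_nonneg_left h2 (sq_nonneg ε)]

lemma exists_H1 {μ : E2 → ℝ} {f : E2 → E2} (hμ : ContDiff ℝ (⊤ : ℕ∞) μ) (hf : ContDiff ℝ (⊤ : ℕ∞) f)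
    {R c : ℝ} (hR : 0 < R) (hc : 0 < c) : ∃ H : E2 → E2, ContDiff ℝ (⊤ : ℕ∞) H ∧ HasCompactSupport H ∧
      ∀ x, ‖x‖ ≤ R → μ x ≤ -c → H x = -(1 / μ x) • f x := by
  let b : ContDiffBump (0 : E2) := ⟨R, R + 1, hR, by linarith⟩
  let θ : ℝ → ℝ := fun m => m / (m^2 + Real.smoothTransition ((m + c)/c))
  have hden : ∀ m : ℝ, m^2 + Real.smoothTransition ((m + c)/c) ≠ 0 := by
    intro m
    have h0 := Real.smoothTransition.nonneg ((m + c)/c)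
    by_cases hm : m = 0
    · subst hm
      rw [zero_add, div_self hc.ne', Real.smoothTransition.one]; norm_num
    · positivity
  have hθ : ContDiff ℝ (⊤ : ℕ∞) θ := by
    refine contDiff_id.div ((contDiff_id.pow 2).add ?_) hden
    exact Real.smoothTransition.contDiff.comp ((contDiff_id.add contDiff_const).div_const c)
  refine ⟨fun x => (b x) • (-(θ (μ x)) • f x), ?_, ?_, ?_⟩
  · exact b.contDiff.smul ((hθ.comp hμ).neg.smul hf)
  · exact b.hasCompactSupport.smul_right
  · intro x hx hm
    have hb : b x = 1 := b.one_of_mem_closedBall (by simpa using hx)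
    have h1 : Real.smoothTransition ((μ x + c)/c) = 0 :=
      Real.smoothTransition.zero_of_nonpos (div_nonpos_of_nonpos_of_nonneg (by linarith) hc.le)
    have h2 : θ (μ x) = 1 / μ x := by
      have : μ x ≠ 0 := by linarith
      simp only [θ, h1]; field_simp; simp
    simp only [hb, h2, one_smul]

lemma lap_smul {H : E2 → E2} (hH : ContDiff ℝ (⊤ : ℕ∞) H) (a : ℝ) (x : E2) :
    lap (fun x => a • H x) x = a • lap H x := by
  unfold lap
  rw [Finset.smul_sum]
  refine Finset.sum_congr rfl fun i _ => ?_
  have h1 : (fun y => fderiv ℝ (fun x => a • H x) y (e2basis i)) =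
      fun y => a • fderiv ℝ H y (e2basis i) := by
    funext y
    have : fderiv ℝ (fun x => a • H x) y = a • fderiv ℝ H y :=
      ((hH.differentiable (by simp) y).hasFDerivAt.const_smul a).fderiv
    rw [this]; rfl
  rw [h1]
  have : fderiv ℝ (fun y => a • fderiv ℝ H y (e2basis i)) x =
      a • fderiv ℝ (fun y => fderiv ℝ H y (e2basis i)) x :=
    (((contDiff_pd hH (e2basis i)).differentiable (by simp) x).hasFDerivAt.const_smul a).fderiv
  rw [this]; rfl

set_option maxHeartbeats 2000000 in
lemma key_est {μ : E2 → ℝ} {μrad : ℝ → ℝ} {ρ : ℝ} {f : E2 → E2} {frad : ℝ → ℝ}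
    (hμ : MuHyp μ μrad ρ) (hf : FHyp f frad) {r0 : ℝ} (hr0 : ρ < r0) {A : ℝ} (hA : 0 ≤ A) :
    ∃ C ε1 η : ℝ, 0 ≤ C ∧ 0 < ε1 ∧ 0 < η ∧ ∀ (ε a : ℝ) (v : E2 → E2), 0 < ε → ε < ε1 → 0 ≤ a → a ≤ A →
      IsMinimizer ε a μ f v → ∀ x : E2, |‖x‖ - r0| ≤ η →
        μ x < 0 ∧ ‖v x + (ε * a / μ x) • f x‖ ≤ C * ε^2 := by
  have hρ := hμ.rho_pos
  obtain ⟨d, hd⟩ : ∃ d, d = (r0 - ρ)/2 := ⟨_, rfl⟩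
  have hd0 : 0 < d := by rw [hd]; linarith
  obtain ⟨c, hcd⟩ : ∃ c, c = - μrad (r0 - d) := ⟨_, rfl⟩
  have hanti := mu_strictAnti hμ
  have hc : 0 < c := by
    have := hanti (show ρ ∈ Ici (0:ℝ) from hρ.le) (show r0 - d ∈ Ici (0:ℝ) by
      simp only [mem_Ici]; linarith) (by linarith)
    rw [hμ.rho_root] at this
    linarith
  have hS : ∀ x ∈ Ann r0 d, μ x ≤ -c := by
    intro x hx
    have h1 := (abs_le.1 (show |‖x‖ - r0| ≤ d from hx)).1
    rw [hμ.radial, hcd, neg_neg]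
    exact hanti.antitoneOn (show r0 - d ∈ Ici (0:ℝ) by
      simp only [mem_Ici]; linarith) (norm_nonneg x) (by linarith)
  have hSR : ∀ x ∈ Ann r0 d, ‖x‖ ≤ r0 + d := by
    intro x hx
    have h1 := (abs_le.1 (show |‖x‖ - r0| ≤ d from hx)).2
    linarith
  obtain ⟨H1, hH1, hH1c, hH1e⟩ := exists_H1 hμ.smooth hf.smooth (R := r0 + d) (by linarith) hc
  have hH1S : ∀ x ∈ Ann r0 d, H1 x = -(1/μ x) • f x := fun x hx => hH1e x (hSR x hx) (hS x hx)
  obtain ⟨M1, hM1⟩ := (isCompact_Ann r0 d).exists_bound_of_continuousOn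
    (continuous_lap hH1).continuousOn
  obtain ⟨M2, hM2⟩ := (isCompact_Ann r0 d).exists_bound_of_continuousOn hH1.continuous.continuousOn
  obtain ⟨M, hM⟩ : ∃ M, M = A * M1 + (A * M2)^3 := ⟨_, rfl⟩
  obtain ⟨φ1, K1, p1, pc1, pn1, po1, pz1, pK1, pl1, plz1⟩ := cutoff_ann r0 (show 2*d/3 < d by linarith)
  obtain ⟨φ2, K2, p2, pc2, pn2, po2, pz2, pK2, pl2, plz2⟩ :=
    cutoff_ann r0 (show d/3 < 2*d/3 by linarith)
  obtain ⟨ε1, hε1, hEdens⟩ := integrable_edens hμ hf.smooth.continuous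
  obtain ⟨C0, hC0⟩ := L2_bound hμ hf A
  have hD : 0 < d^2/72 := by positivity
  obtain ⟨κ, L, hκ, hL, hsub⟩ := submean hD
  have hH1i : Integrable (fun x => ‖H1 x‖^2) := integrable_normsq_of_memLp (memH1_smooth hH1 hH1c).2.1
  obtain ⟨Q0, hQ0⟩ : ∃ Q0, Q0 = 2 * |C0| + 2 * A^2 * ∫ x, ‖H1 x‖^2 := ⟨_, rfl⟩
  have hIH : 0 ≤ ∫ x, ‖H1 x‖^2 := integral_nonneg fun x => sq_nonneg _
  have hQ0n : 0 ≤ Q0 := by rw [hQ0]; positivity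
  have hI1 : 0 ≤ ∫ x, φ1 x := integral_nonneg pn1
  have hI2 : 0 ≤ ∫ x, φ2 x := integral_nonneg pn2
  obtain ⟨Q1, hQ1⟩ : ∃ Q1, Q1 = (K1 * Q0 + (M^2/c) * ∫ x, φ1 x)/c := ⟨_, rfl⟩
  have hQ1n : 0 ≤ Q1 := by rw [hQ1]; positivity
  obtain ⟨Q2, hQ2⟩ : ∃ Q2, Q2 = (K2 * Q1 + (M^2/c) * ∫ x, φ2 x)/c := ⟨_, rfl⟩
  have hQ2n : 0 ≤ Q2 := by rw [hQ2]; positivity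
  obtain ⟨Z, hZ⟩ : ∃ Z, Z = (L * Q2 + d^2/72 * κ * (M^2/c))/κ := ⟨_, rfl⟩
  have hZn : 0 ≤ Z := by rw [hZ]; positivity
  refine ⟨√Z, min ε1 1, d/6, Real.sqrt_nonneg _, lt_min hε1 one_pos, by positivity, ?_⟩
  intro ε a v hε hεlt ha haA hmin x0 hx0
  have hεε1 := hεlt.trans_le (min_le_left _ _)
  have hε1' := (hεlt.trans_le (min_le_right _ _)).le
  have hinte := hEdens ε a v hε hεε1 hmin
  have hvL := hC0 ε a v hε hε1' ha haA hmin hinte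
  have hx0S : x0 ∈ Ann r0 d := show |‖x0‖ - r0| ≤ d by linarith
  have hμx0 : μ x0 < 0 := by linarith [hS x0 hx0S]
  refine ⟨hμx0, ?_⟩
  -- the comparison map
  let H : E2 → E2 := fun x => a • H1 x
  have hH : ContDiff ℝ (⊤ : ℕ∞) H := hH1.const_smul a
  have hHc : HasCompactSupport H := HasCompactSupport.smul_left (f := fun _ => a) hH1c
  have hHeq : ∀ x ∈ Ann r0 d, μ x • H x + a • f x = 0 := by
    intro x hx
    have : μ x ≠ 0 := by linarith [hS x hx]
    simp only [H]
    rw [hH1S x hx, smul_smul, smul_smul, ← add_smul]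
    have h0 : μ x * (a * -(1 / μ x)) + a = 0 := by field_simp; ring
    rw [← mul_assoc] at h0
    rw [h0, zero_smul]
  have hHM : ∀ x ∈ Ann r0 d, ‖lap H x‖ + ‖H x‖^3 ≤ M := by
    intro x hx
    have h1 := hM1 x hx
    have h2 := hM2 x hx
    have e1 : ‖lap H x‖ ≤ A * M1 := by
      simp only [H]
      rw [lap_smul hH1, norm_smul, Real.norm_eq_abs, abs_of_nonneg ha]
      exact mul_le_mul haA h1 (norm_nonneg _) hA
    have e2 : ‖H x‖ ≤ A * M2 := by
      simp only [H]
      rw [norm_smul, Real.norm_eq_abs, abs_of_nonneg ha]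
      exact mul_le_mul haA h2 (norm_nonneg _) hA
    rw [hM]
    exact add_le_add e1 (pow_le_pow_left₀ (norm_nonneg _) e2 3)
  have hmain : ∀ χ : E2 → ℝ, ContDiff ℝ (⊤ : ℕ∞) χ → HasCompactSupport χ → (∀ x, 0 ≤ χ x) →
      (∀ x, x ∉ Ann r0 d → χ x = 0) →
      c * (∫ x, χ x * ‖v x - ε • H x‖^2) ≤ ε^2 * (∫ x, lapS χ x * ‖v x - ε • H x‖^2)
        + (M^2/c) * ε^6 * ∫ x, χ x := fun χ h1 h2 h3 h4 =>
    main_ineq hε hc hμ.smooth.continuous hf.smooth.continuous hmin hinte (Ann r0 d) hS hH hHc hHeq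
      hHM h1 h2 h3 h4
  let q : E2 → ℝ := fun x => ‖v x - ε • H x‖^2
  have hvc : Continuous v := hmin.1.1.continuous
  have hq : Continuous q := ((hvc.sub (hH.continuous.const_smul ε)).norm.pow 2)
  have hq0 : ∀ x, 0 ≤ q x := fun x => sq_nonneg _
  have hvi : Integrable (fun x => ‖v x‖^2) := integrable_normsq_of_memLp hmin.1.2.1
  have hqle : ∀ x, q x ≤ 2 * ‖v x‖^2 + 2 * A^2 * ‖H1 x‖^2 := by
    intro x
    have h1 : ‖v x - ε • H x‖ ≤ ‖v x‖ + A * ‖H1 x‖ := by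
      refine (norm_sub_le _ _).trans (add_le_add le_rfl ?_)
      simp only [H]
      rw [smul_smul, norm_smul, Real.norm_eq_abs, abs_of_nonneg (by positivity)]
      refine mul_le_mul_of_nonneg_right ?_ (norm_nonneg _)
      nlinarith
    have h2 : q x ≤ (‖v x‖ + A * ‖H1 x‖)^2 := pow_le_pow_left₀ (norm_nonneg _) h1 2
    nlinarith [sq_nonneg (‖v x‖ - A * ‖H1 x‖)]
  have s0 : (∫ x in Ann r0 d, q x) ≤ Q0 := by
    have i1 : Integrable (fun x => 2 * ‖v x‖^2 + 2 * A^2 * ‖H1 x‖^2) :=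
      (hvi.const_mul 2).add (hH1i.const_mul (2 * A^2))
    calc (∫ x in Ann r0 d, q x) ≤ ∫ x in Ann r0 d, (2 * ‖v x‖^2 + 2 * A^2 * ‖H1 x‖^2) :=
          setIntegral_mono (hq.continuousOn.integrableOn_compact (isCompact_Ann r0 d))
            i1.integrableOn hqle
      _ ≤ ∫ x, (2 * ‖v x‖^2 + 2 * A^2 * ‖H1 x‖^2) :=
          setIntegral_le_integral i1 (Eventually.of_forall fun x => by positivity)
      _ = 2 * (∫ x, ‖v x‖^2) + 2 * A^2 * ∫ x, ‖H1 x‖^2 := by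
          rw [integral_add (hvi.const_mul 2) (hH1i.const_mul (2 * A^2)), integral_const_mul,
            integral_const_mul]
      _ ≤ Q0 := by rw [hQ0]; linarith [le_abs_self C0]
  have hε6 : ε^6 ≤ ε^2 := pow_le_pow_of_le_one hε.le hε1' (by norm_num)
  have hε64 : ε^6 ≤ ε^4 := pow_le_pow_of_le_one hε.le hε1' (by norm_num)
  have s1 : (∫ x in Ann r0 (2*d/3), q x) ≤ Q1 * ε^2 := by
    have := cutoff_step (q := q) p1 pc1 pn1 po1 pl1 plz1 hq hq0 hc.le (hmain φ1 p1 pc1 pn1 pz1)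
    have h2 : ε^2 * (K1 * ∫ x in Ann r0 d, q x) ≤ ε^2 * (K1 * Q0) := by gcongr
    have h3 : M^2/c * ε^6 * (∫ x, φ1 x) ≤ M^2/c * ε^2 * ∫ x, φ1 x := by gcongr
    have h4 : c * (∫ x in Ann r0 (2*d/3), q x) ≤ c * (Q1 * ε^2) := by
      refine (this.trans (add_le_add h2 h3)).trans (le_of_eq ?_)
      rw [hQ1]; field_simp
    exact le_of_mul_le_mul_left h4 hc
  have s2 : (∫ x in Ann r0 (d/3), q x) ≤ Q2 * ε^4 := by
    have hz : ∀ x, x ∉ Ann r0 d → φ2 x = 0 := fun x hx => pz2 x fun hx' => hx (by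
      have : |‖x‖ - r0| ≤ 2*d/3 := hx'
      exact (show |‖x‖ - r0| ≤ d by linarith))
    have := cutoff_step (q := q) p2 pc2 pn2 po2 pl2 plz2 hq hq0 hc.le (hmain φ2 p2 pc2 pn2 hz)
    have h2 : ε^2 * (K2 * ∫ x in Ann r0 (2*d/3), q x) ≤ ε^2 * (K2 * (Q1 * ε^2)) := by gcongr
    have h3 : M^2/c * ε^6 * (∫ x, φ2 x) ≤ M^2/c * ε^4 * ∫ x, φ2 x := by gcongr
    have h4 : c * (∫ x in Ann r0 (d/3), q x) ≤ c * (Q2 * ε^4) := by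
      refine (this.trans (add_le_add h2 h3)).trans (le_of_eq ?_)
      rw [hQ2]; field_simp
    exact le_of_mul_le_mul_left h4 hc
  have hball : ∀ x : E2, ‖x - x0‖^2 ≤ 2*(d^2/72) → x ∈ Ann r0 (d/3) := by
    intro x hx
    have h1 : ‖x - x0‖ ≤ d/6 := by
      refine le_of_sq_le_sq ?_ (by positivity)
      calc ‖x - x0‖^2 ≤ _ := hx
        _ = (d/6)^2 := by ring
    have h2 : |‖x‖ - ‖x0‖| ≤ ‖x - x0‖ := abs_norm_sub_norm_le _ _
    show |‖x‖ - r0| ≤ d/3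
    calc |‖x‖ - r0| ≤ |‖x‖ - ‖x0‖| + |‖x0‖ - r0| := abs_sub_le _ _ _
      _ ≤ d/3 := by linarith
  have hfin := hsub x0 q (M^2/c * ε^4) hq hq0 (by positivity) (by
    intro χ h1 h2 h3 h4
    have hz : ∀ x, x ∉ Ann r0 d → χ x = 0 := by
      intro x hx
      refine h4 x (not_le.1 fun hle => hx ?_)
      have : |‖x‖ - r0| ≤ d/3 := hball x hle
      exact (show |‖x‖ - r0| ≤ d by linarith)
    have h5 := hmain χ h1 h2 h3 hz
    have h6 : 0 ≤ c * (∫ x, χ x * q x) :=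
      mul_nonneg hc.le (integral_nonneg fun x => mul_nonneg (h3 x) (hq0 x))
    have h7 : 0 ≤ ε^2 * ((∫ x, lapS χ x * q x) + M^2/c * ε^4 * ∫ x, χ x) := by
      refine (h6.trans h5).trans (le_of_eq ?_)
      simp only [q]; ring
    have h8 := nonneg_of_mul_nonneg_right h7 (by positivity : 0 < ε^2)
    linarith)
  have s3 : (∫ x in {x : E2 | ‖x - x0‖^2 ≤ 2*(d^2/72)}, q x) ≤ Q2 * ε^4 := by
    refine le_trans ?_ s2
    exact setIntegral_mono_set (hq.continuousOn.integrableOn_compact (isCompact_Ann r0 _))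
      (Eventually.of_forall hq0) (Eventually.of_forall hball)
  have s4 : q x0 ≤ Z * ε^4 := by
    have : κ * q x0 ≤ κ * (Z * ε^4) := by
      refine hfin.trans ((add_le_add (mul_le_mul_of_nonneg_left s3 hL) le_rfl).trans (le_of_eq ?_))
      rw [hZ]; field_simp
    exact le_of_mul_le_mul_left this hκ
  have e1 : v x0 - ε • H x0 = v x0 + (ε * a / μ x0) • f x0 := by
    simp only [H]
    rw [hH1S x0 hx0S, sub_eq_add_neg, smul_smul, smul_smul, ← neg_smul]
    congr 2
    ring
  rw [← e1]
  refine le_of_sq_le_sq ?_ (by positivity)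
  calc ‖v x0 - ε • H x0‖^2 ≤ Z * ε^4 := s4
    _ = (√Z * ε^2)^2 := by rw [mul_pow, Real.sq_sqrt hZn]; ring

/-- outside the circle `|x| = ρ`, for `r₀ > ρ`,
`v_{ε,a}((r₀+tε)e^{iθ})/ε → −(a₀/μ_rad(r₀)) f(r₀e^{iθ})` uniformly for `t` bounded
and `θ ∈ ℝ`. -/
theorem statement3
    (μ : E2 → ℝ) (μrad : ℝ → ℝ) (ρ : ℝ) (f : E2 → E2) (frad : ℝ → ℝ)
    (hμ : MuHyp μ μrad ρ) (hf : FHyp f frad)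
    (a : ℝ → ℝ) (a0 : ℝ) (ha0 : ∀ ε : ℝ, 0 < ε → 0 ≤ a ε)
    (haB : ∃ C : ℝ, ∀ ε : ℝ, 0 < ε → a ε ≤ C)
    (halim : Tendsto a (𝓝[>] (0:ℝ)) (𝓝 a0))
    (v : ℝ → E2 → E2) (hv : ∀ ε : ℝ, 0 < ε → IsMinimizer ε (a ε) μ f (v ε))
    (r0 : ℝ) (hr0 : ρ < r0) :
    ∀ δ : ℝ, 0 < δ → ∀ T : ℝ, 0 < T → ∃ ε₀ : ℝ, 0 < ε₀ ∧
      ∀ ε : ℝ, 0 < ε → ε < ε₀ → ∀ t : ℝ, |t| ≤ T → ∀ e : E2, ‖e‖ = 1 →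
        ‖ε⁻¹ • v ε ((r0 + t*ε) • e) + (a0 / μrad r0) • f (r0 • e)‖ < δ := by
  intro δ hδ T hT
  have hρ := hμ.rho_pos
  have hr0p : 0 < r0 := hρ.trans hr0
  obtain ⟨A, hA⟩ := haB
  have hA0 : 0 ≤ A := (ha0 1 one_pos).trans (hA 1 one_pos)
  obtain ⟨C, ε1, η, hC, hε1, hη, hkey⟩ := key_est hμ hf hr0 hA0
  have hne : μrad r0 ≠ 0 := fun h => hr0.ne' (hμ.rho_unique r0 hr0p h)
  have hcont : Tendsto (fun p : ℝ × ℝ => p.1 * frad p.2 / μrad p.2) (𝓝 (a0, r0))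
      (𝓝 (a0 * frad r0 / μrad r0)) := by
    have : ContinuousAt (fun p : ℝ × ℝ => p.1 * frad p.2 / μrad p.2) (a0, r0) :=
      ContinuousAt.div (continuous_fst.mul (hf.smooth_rad.continuous.comp continuous_snd)).continuousAt
        (hμ.smooth_rad.continuous.comp continuous_snd).continuousAt hne
    exact this
  obtain ⟨τ, hτ, hτc⟩ := Metric.tendsto_nhds_nhds.1 hcont (δ/2) (by positivity)
  obtain ⟨ε2, hε2, hε2a⟩ := Metric.tendsto_nhdsWithin_nhds.1 halim τ hτ
  refine ⟨min (min ε1 ε2) (min (min (η/T) (τ/T)) (min (r0/T) (δ/(2*(C+1))))), by positivity, ?_⟩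
  intro ε hε hεlt t ht e he
  simp only [lt_min_iff] at hεlt
  obtain ⟨⟨h1, h2⟩, ⟨h3, h4⟩, h5, h6⟩ := hεlt
  rw [lt_div_iff₀ hT] at h3 h4 h5
  rw [lt_div_iff₀ (by positivity)] at h6
  have htε : |t * ε| ≤ ε * T := by
    rw [abs_mul, abs_of_pos hε, mul_comm]; gcongr
  obtain ⟨r, hr⟩ : ∃ r, r = r0 + t * ε := ⟨_, rfl⟩
  have hrr0 : r - r0 = t * ε := by rw [hr]; ring
  have hrpos : 0 < r := by rw [hr]; linarith [(abs_le.1 htε).1]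
  have hnorm : ∀ s : ℝ, 0 < s → ‖s • e‖ = s := fun s hs => by
    rw [norm_smul, he, mul_one, Real.norm_eq_abs, abs_of_pos hs]
  have hfe : ∀ s : ℝ, 0 < s → f (s • e) = frad s • e := fun s hs => by
    have hne0 : s • e ≠ 0 := by
      rw [← norm_ne_zero_iff, hnorm s hs]; exact hs.ne'
    rw [hf.radial _ hne0, hnorm s hs, smul_smul, div_mul_cancel₀ _ hs.ne']
  rw [← hr]
  obtain ⟨hneg, hk⟩ := hkey ε (a ε) (v ε) hε h1 (ha0 ε hε) (hA ε hε) (hv ε hε) (r • e) (by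
    rw [hnorm r hrpos, hrr0]; linarith)
  rw [hμ.radial, hnorm r hrpos] at hneg hk
  rw [hfe r hrpos] at hk
  rw [hfe r0 hr0p]
  have hd := hτc (x := (a ε, r)) (by
    rw [Prod.dist_eq]
    refine max_lt ?_ ?_
    · exact hε2a hε (by rw [Real.dist_eq, sub_zero, abs_of_pos hε]; exact h2)
    · rw [Real.dist_eq, hrr0]; linarith)
  rw [Real.dist_eq] at hd
  have hsplit : ε⁻¹ • v ε (r • e) + (a0 / μrad r0) • frad r0 • e
      = ε⁻¹ • (v ε (r • e) + (ε * a ε / μrad r) • frad r • e)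
        - (a ε * frad r / μrad r - a0 * frad r0 / μrad r0) • e := by
    have e1 : ε⁻¹ * (ε * a ε / μrad r) * frad r = a ε * frad r / μrad r := by
      field_simp
    rw [smul_add, smul_smul, smul_smul, smul_smul, e1, sub_smul,
      div_mul_eq_mul_div a0]
    abel
  rw [hsplit]
  have n1 : ‖ε⁻¹ • (v ε (r • e) + (ε * a ε / μrad r) • frad r • e)‖ ≤ C * ε := by
    rw [norm_smul, Real.norm_eq_abs, abs_of_pos (inv_pos.2 hε)]
    calc ε⁻¹ * _ ≤ ε⁻¹ * (C * ε^2) := by gcongr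
      _ = C * ε := by field_simp
  have n2 : ‖(a ε * frad r / μrad r - a0 * frad r0 / μrad r0) • e‖ < δ/2 := by
    rw [norm_smul, he, mul_one]; exact hd
  have := norm_sub_le (ε⁻¹ • (v ε (r • e) + (ε * a ε / μrad r) • frad r • e))
    ((a ε * frad r / μrad r - a0 * frad r0 / μrad r0) • e)
  nlinarith
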